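/- arXiv:2212.13553 — 7 statements merged into one kernel-verified Lean document; each statement's English description precedes it below -/
import Mathlib

section
/- Let d ≥ 1 and y₁, …, y_{d+1} ∈ ℝ^d with y_{d+1} = 0. Then the function w ↦ det( (y₁ − w)^ − (y₂ − w)^, (y₂ − w)^ − (y₃ − w)^, …, (y_d − w)^ − (y_{d+1} − w)^ ) is Lebesgue-integrable on ℝ^d and its integral over ℝ^d equals vol(B₁) · det(y₁, …, y_d), where vol(B₁) is the Lebesgue measure of the unit ball of ℝ^d and det(y₁, …, y_d) is the determinant of the d×d real matrix whose j-th column is y_j. (For even d this is the determinant form, via the Clifford trace–determinant identity, of the paper's geometric identity ∫ tr(γ₀ ∏ γ·(ŷᵢ−w − ŷᵢ₊₁−w)) dw = Λ_d Σ_λ sgn(λ) ∏ (y_i)_{λ_i}.) -/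
open scoped Classical
open MeasureTheory

/-- The normalization map: `v̂ = v/‖v‖` if `v ≠ 0`, and `0̂ = 0`. -/
noncomputable def unitHat {d : ℕ} (v : EuclideanSpace ℝ (Fin d)) : EuclideanSpace ℝ (Fin d) :=
  if v = 0 then 0 else ‖v‖⁻¹ • v

/-- The determinant-form integrand
`w ↦ det((y₁ − w)^ − (y₂ − w)^, …, (y_d − w)^ − (y_{d+1} − w)^)`,
where the `j`-th column of the matrix is `(y_j − w)^ − (y_{j+1} − w)^`. -/
noncomputable def detIntegrand {d : ℕ} (y : Fin (d + 1) → EuclideanSpace ℝ (Fin d))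
    (w : EuclideanSpace ℝ (Fin d)) : ℝ :=
  (Matrix.of fun i j : Fin d =>
    (unitHat (y j.castSucc - w) - unitHat (y j.succ - w)) i).det

open Filter Topology Set Module
open scoped RealInnerProductSpace

section Determinant

variable {d : ℕ}

local notation "E" => EuclideanSpace ℝ (Fin d)

/-- The determinant of `d` vectors of `ℝ^d`, as an alternating map. -/
noncomputable def detCols : E [⋀^Fin d]→ₗ[ℝ] ℝ :=
  (EuclideanSpace.basisFun (Fin d) ℝ).toBasis.det

theorem detCols_apply (v : Fin d → E) : detCols v = (Matrix.of fun i j => v j i).det := by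
  rw [detCols, Basis.det_apply]
  congr 1

theorem detCols_comp (T : E →ₗ[ℝ] E) (v : Fin d → E) :
    detCols (fun j => T (v j)) = LinearMap.det T * detCols v :=
  Basis.det_comp _ T v

/-- The effect on the determinant of a rank one perturbation of the identity. -/
theorem detCols_add_inner_smul (m a : E) (v : Fin d → E) :
    detCols (fun j => v j + ⟪m, v j⟫ • a) = (1 + ⟪m, a⟫) * detCols v := by
  have h := detCols_comp (LinearMap.transvection (innerSL ℝ m).toLinearMap a) v
  rw [LinearMap.transvection.det] at h
  simpa [LinearMap.transvection] using h

theorem abs_detCols_le (v : Fin d → E) {c : ℝ} (h : ∀ j, ‖v j‖ ≤ c) :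
    |detCols v| ≤ d.factorial * c ^ d := by
  rw [detCols_apply]
  have := Matrix.det_le (A := Matrix.of fun i j => v j i) (abv := AbsoluteValue.abs) (x := c)
    fun i j => (by simpa using (PiLp.norm_apply_le (v j) i).trans (h j))
  simpa using this

theorem detCols_transpose_mulVec (p : Fin d → E) (m : E) (j : Fin d) :
    ((Matrix.of fun i j => p j i).transpose.mulVec m.ofLp) j = ⟪m, p j⟫ := by
  simp [Matrix.mulVec, dotProduct, PiLp.inner_apply]

theorem exists_inner_eq_zero {p : Fin d → E} (h : detCols p = 0) :
    ∃ m : E, m ≠ 0 ∧ ∀ j, ⟪m, p j⟫ = 0 := by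
  rw [detCols_apply, ← Matrix.det_transpose] at h
  obtain ⟨v, hv, hv0⟩ := Matrix.exists_mulVec_eq_zero_iff.2 h
  refine ⟨WithLp.toLp 2 v, by simpa using hv, fun j => ?_⟩
  rw [← detCols_transpose_mulVec]
  exact congrFun hv0 j

theorem exists_inner_eq_one {p : Fin d → E} (h : detCols p ≠ 0) :
    ∃ m : E, ∀ j, ⟪m, p j⟫ = 1 := by
  rw [detCols_apply, ← Matrix.det_transpose] at h
  refine ⟨WithLp.toLp 2 ((Matrix.of fun i j => p j i).transpose⁻¹.mulVec 1), fun j => ?_⟩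
  rw [← detCols_transpose_mulVec]
  simp only [Matrix.mulVec_mulVec]
  rw [Matrix.mul_nonsing_inv _ (isUnit_iff_ne_zero.2 h)]
  simp

theorem unitHat_eq (v : E) : unitHat v = ‖v‖⁻¹ • v := by
  unfold unitHat
  split_ifs with h <;> simp [h]

theorem norm_unitHat_of_ne_zero {v : E} (h : v ≠ 0) : ‖unitHat v‖ = 1 := by
  rw [unitHat_eq, norm_smul, norm_inv, norm_norm, inv_mul_cancel₀ (norm_ne_zero_iff.2 h)]

theorem norm_unitHat_le (v : E) : ‖unitHat v‖ ≤ 1 := by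
  rcases eq_or_ne v 0 with h | h
  · simp [unitHat, h]
  · exact (norm_unitHat_of_ne_zero h).le

theorem measurable_unitHat : Measurable (unitHat : E → E) := by
  have : (unitHat : E → E) = fun v => ‖v‖⁻¹ • v := funext unitHat_eq
  rw [this]
  fun_prop

theorem unitHat_smul {t : ℝ} (ht : 0 < t) (v : E) : unitHat (t • v) = unitHat v := by
  rw [unitHat_eq, unitHat_eq, norm_smul, Real.norm_of_nonneg ht.le, smul_smul]
  congr 1
  field_simp

theorem unitHat_map (R : E ≃ₗᵢ[ℝ] E) (v : E) : unitHat (R v) = R (unitHat v) := by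
  simp [unitHat_eq]

/-- The determinant of the unit vectors pointing from `w` to the points `p j`. -/
noncomputable def detHat (p : Fin d → E) (w : E) : ℝ := detCols fun j => unitHat (p j - w)

theorem detHat_eq_div (p : Fin d → E) (w : E) :
    detHat p w = detCols (fun j => p j - w) / ∏ j, ‖p j - w‖ := by
  simp only [detHat, unitHat_eq]
  have := (detCols (d := d)).map_smul_univ (fun j => ‖p j - w‖⁻¹) (fun j => p j - w)
  rw [this, Finset.prod_inv_distrib, smul_eq_mul]
  ring

theorem detHat_sub_add (p : Fin d → E) (q z : E) :
    detHat p (z + q) = detHat (fun j => p j - q) z := by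
  simp only [detHat]
  congr 1
  funext j
  congr 1
  abel

theorem detHat_smul {t : ℝ} (ht : 0 < t) (p : Fin d → E) (w : E) :
    detHat (fun j => t • p j) (t • w) = detHat p w := by
  simp only [detHat, ← smul_sub, unitHat_smul ht]

theorem abs_detHat_le (p : Fin d → E) (w : E) : |detHat p w| ≤ d.factorial := by
  simpa [detHat] using abs_detCols_le (fun j => unitHat (p j - w)) fun j => norm_unitHat_le _

theorem measurable_detCols {α : Type*} [MeasurableSpace α] {v : Fin d → α → E}
    (h : ∀ j, Measurable (v j)) : Measurable fun w => detCols fun j => v j w := by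
  have hc : Continuous (detCols : (Fin d → E) → ℝ) := by
    have : (detCols : (Fin d → E) → ℝ) = fun v => (Matrix.of fun i j => v j i).det :=
      funext detCols_apply
    rw [this]
    exact Continuous.matrix_det (by fun_prop)
  exact hc.measurable.comp (measurable_pi_lambda _ h)

theorem measurable_detHat (p : Fin d → E) : Measurable (detHat p) :=
  measurable_detCols fun _ => measurable_unitHat.comp (by fun_prop)

/-- If all the points lie in the hyperplane `mᗮ`, then `detHat` is odd under the reflection in
that hyperplane. -/
theorem detHat_reflection {p : Fin d → E} {m : E} (hm : m ≠ 0) (hp : ∀ j, ⟪m, p j⟫ = 0) (z : E) :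
    detHat p ((ℝ ∙ m)ᗮ.reflection z) = -detHat p z := by
  have h (j) : unitHat (p j - (ℝ ∙ m)ᗮ.reflection z)
      = (ℝ ∙ m)ᗮ.reflection.toLinearMap (unitHat (p j - z)) := by
    have : (ℝ ∙ m)ᗮ.reflection (p j) = p j :=
      Submodule.reflection_mem_subspace_eq_self
        (Submodule.mem_orthogonal_singleton_iff_inner_right.2 (hp j))
    conv_lhs => rw [← this, ← map_sub, unitHat_map]
    rfl
  simp only [detHat, h]
  rw [detCols_comp, Submodule.det_reflection, Submodule.orthogonal_orthogonal,
    finrank_span_singleton hm]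
  simp

theorem integrable_detHat_mul (p : Fin d → E) {g : E → ℝ} (hg : Integrable g) :
    Integrable fun z => detHat p z * g z :=
  hg.bdd_mul (measurable_detHat p).aestronglyMeasurable (ae_of_all _ (abs_detHat_le p))

/-- Two times the integral against `detHat`, symmetrised by the reflection in `mᗮ`. -/
theorem two_mul_integral_detHat_mul {p : Fin d → E} {m : E} (hm : m ≠ 0)
    (hp : ∀ j, ⟪m, p j⟫ = 0) {g : E → ℝ} (hg : Integrable g) :
    2 * ∫ z, detHat p z * g z
      = ∫ z, detHat p z * (g z - g ((ℝ ∙ m)ᗮ.reflection z)) := by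
  have hmp := (ℝ ∙ m)ᗮ.reflection.measurePreserving
  have hemb := (ℝ ∙ m)ᗮ.reflection.toHomeomorph.measurableEmbedding
  have h1 : ∫ z, detHat p z * g z = -∫ z, detHat p z * g ((ℝ ∙ m)ᗮ.reflection z) := by
    rw [← integral_neg, ← hmp.integral_comp hemb]
    simp [detHat_reflection hm hp]
  have h2 : Integrable fun z => g ((ℝ ∙ m)ᗮ.reflection z) :=
    (hmp.integrable_comp_emb hemb).2 hg
  simp only [mul_sub]
  rw [integral_sub (integrable_detHat_mul p hg) (integrable_detHat_mul p h2), two_mul]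
  linarith

end Determinant

section Decay

variable {d : ℕ}

local notation "E" => EuclideanSpace ℝ (Fin d)

theorem norm_unitHat_sub_add_unitHat_le {a w : E} (hw : w ≠ 0) (haw : a - w ≠ 0) :
    ‖unitHat (a - w) + unitHat w‖ ≤ 2 * ‖a‖ / ‖w‖ := by
  have hw' : 0 < ‖w‖ := norm_pos_iff.2 hw
  have haw' : 0 < ‖a - w‖ := norm_pos_iff.2 haw
  have h : unitHat (a - w) + unitHat w
      = ‖w‖⁻¹ • a + (1 - ‖w‖⁻¹ * ‖a - w‖) • unitHat (a - w) := by
    rw [sub_smul, one_smul, mul_smul, unitHat_eq (a - w), smul_inv_smul₀ haw'.ne', unitHat_eq w,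
      smul_sub ‖w‖⁻¹ a w]
    abel
  rw [h, le_div_iff₀ hw']
  have h2 : |1 - ‖w‖⁻¹ * ‖a - w‖| ≤ ‖w‖⁻¹ * ‖a‖ := by
    have : 1 - ‖w‖⁻¹ * ‖a - w‖ = ‖w‖⁻¹ * (‖w‖ - ‖a - w‖) := by field_simp
    rw [this, abs_mul, abs_of_pos (inv_pos.2 hw')]
    gcongr
    have := abs_norm_sub_norm_le w (w - a)
    rwa [sub_sub_cancel, norm_sub_rev w a] at this
  calc _ ≤ (‖w‖⁻¹ * ‖a‖ + ‖w‖⁻¹ * ‖a‖ * 1) * ‖w‖ := by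
        gcongr
        refine (norm_add_le _ _).trans ?_
        rw [norm_smul, norm_smul, norm_inv, norm_norm, Real.norm_eq_abs]
        gcongr
        exact norm_unitHat_le _
    _ = 2 * ‖a‖ := by field_simp; ring

theorem abs_inner_unitHat_sub_add_one_le {a w : E} (hw : w ≠ 0) (haw : a - w ≠ 0) :
    |⟪unitHat w, unitHat (a - w)⟫ + 1| ≤ 2 * ‖a‖ ^ 2 / ‖w‖ ^ 2 := by
  have h := norm_add_sq_real (unitHat w) (unitHat (a - w))
  rw [norm_unitHat_of_ne_zero hw, norm_unitHat_of_ne_zero haw] at h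
  have h1 := norm_unitHat_sub_add_unitHat_le hw haw
  rw [add_comm] at h1
  have h2 := pow_le_pow_left₀ (norm_nonneg _) h1 2
  rw [div_pow] at h2
  have h3 : ⟪unitHat w, unitHat (a - w)⟫ + 1 = ‖unitHat w + unitHat (a - w)‖ ^ 2 / 2 := by
    linarith
  rw [h3, abs_of_nonneg (by positivity), div_le_iff₀ two_pos]
  refine h2.trans (le_of_eq ?_)
  ring

theorem detIntegrand_eq_detCols (y : Fin (d + 1) → E) (w : E) :
    detIntegrand y w
      = detCols fun j => unitHat (y j.castSucc - w) - unitHat (y j.succ - w) := by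
  rw [detCols_apply, detIntegrand]

theorem measurable_detIntegrand (y : Fin (d + 1) → E) : Measurable (detIntegrand y) := by
  have : detIntegrand y = fun w => _ := funext (detIntegrand_eq_detCols y)
  rw [this]
  exact measurable_detCols fun j =>
    (measurable_unitHat.comp (by fun_prop)).sub (measurable_unitHat.comp (by fun_prop))

theorem abs_detIntegrand_le (y : Fin (d + 1) → E) (w : E) :
    |detIntegrand y w| ≤ d.factorial * 2 ^ d := by
  rw [detIntegrand_eq_detCols]
  refine abs_detCols_le _ fun j => (norm_sub_le _ _).trans ?_
  linarith [norm_unitHat_le (y j.castSucc - w), norm_unitHat_le (y j.succ - w)]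

/-- The differences of unit vectors are `O(‖w‖⁻¹)` and their components along `w` are
`O(‖w‖⁻²)`, so the determinant is `O(‖w‖^(-(d+1)))`. -/
theorem abs_detIntegrand_mul_pow_le {y : Fin (d + 1) → E} {M : ℝ} (hM : ∀ j, ‖y j‖ ≤ M)
    {w : E} (hw : M + 1 ≤ ‖w‖) :
    |detIntegrand y w| * ‖w‖ ^ (d + 1) ≤ d.factorial * (4 * M + 4 * M ^ 2) ^ d := by
  have hM0 : 0 ≤ M := (norm_nonneg _).trans (hM 0)
  have hw' : 0 < ‖w‖ := by linarith
  have hw0 : w ≠ 0 := norm_pos_iff.1 hw'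
  have hy (j) : y j - w ≠ 0 := fun h => by
    rw [sub_eq_zero] at h
    have := hM j
    rw [h] at this
    linarith
  set e := unitHat w with he
  set v : Fin d → E := fun j => unitHat (y j.castSucc - w) - unitHat (y j.succ - w) with hv
  have hv1 (j) : ‖v j‖ ≤ 4 * M / ‖w‖ := by
    have h : v j = (unitHat (y j.castSucc - w) + e) - (unitHat (y j.succ - w) + e) := by
      simp [hv]
    have hk (k) : ‖unitHat (y k - w) + e‖ ≤ 2 * M / ‖w‖ :=
      (norm_unitHat_sub_add_unitHat_le hw0 (hy k)).trans (by gcongr; exact hM k)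
    rw [h]
    refine (norm_sub_le _ _).trans ((add_le_add (hk _) (hk _)).trans (le_of_eq ?_))
    ring
  have hv2 (j) : |⟪e, v j⟫| ≤ 4 * M ^ 2 / ‖w‖ ^ 2 := by
    have h : ⟪e, v j⟫ = (⟪e, unitHat (y j.castSucc - w)⟫ + 1)
        - (⟪e, unitHat (y j.succ - w)⟫ + 1) := by
      simp [hv, inner_sub_right]
    have hk (k) : |⟪e, unitHat (y k - w)⟫ + 1| ≤ 2 * M ^ 2 / ‖w‖ ^ 2 :=
      (abs_inner_unitHat_sub_add_one_le hw0 (hy k)).trans (by gcongr; exact hM k)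
    rw [h]
    refine (abs_sub _ _).trans ((add_le_add (hk _) (hk _)).trans (le_of_eq ?_))
    ring
  have hdet := detCols_add_inner_smul e ((‖w‖ - 1) • e) v
  rw [inner_smul_right, real_inner_self_eq_norm_sq, he, norm_unitHat_of_ne_zero hw0, ← he] at hdet
  have hb := abs_detCols_le (fun j => v j + ⟪e, v j⟫ • (‖w‖ - 1) • e)
    (c := (4 * M + 4 * M ^ 2) / ‖w‖) fun j => by
      refine (norm_add_le _ _).trans ?_
      rw [norm_smul, norm_smul, he, norm_unitHat_of_ne_zero hw0, ← he, add_div, mul_one]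
      refine add_le_add (hv1 j) ?_
      rw [Real.norm_eq_abs, Real.norm_of_nonneg (by linarith)]
      calc _ ≤ 4 * M ^ 2 / ‖w‖ ^ 2 * ‖w‖ := by gcongr; exacts [by linarith, hv2 j, by linarith]
        _ = _ := by field_simp
  rw [hdet, abs_mul] at hb
  have h1 : |1 + (‖w‖ - 1) * 1 ^ 2| = ‖w‖ := by
    rw [one_pow, mul_one, add_sub_cancel, abs_of_pos hw']
  rw [h1, div_pow, ← mul_div_assoc, le_div_iff₀ (by positivity)] at hb
  rw [detIntegrand_eq_detCols]
  calc _ = ‖w‖ * |detCols v| * ‖w‖ ^ d := by ring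
    _ ≤ _ := hb

theorem integrable_detIntegrand (y : Fin (d + 1) → E) : Integrable (detIntegrand y) := by
  obtain ⟨M, hM⟩ : ∃ M, ∀ j, ‖y j‖ ≤ M :=
    ⟨∑ j, ‖y j‖, fun j => Finset.single_le_sum (f := fun j => ‖y j‖)
      (fun _ _ => norm_nonneg _) (Finset.mem_univ j)⟩
  have hM0 : 0 ≤ M := (norm_nonneg _).trans (hM 0)
  set K : ℝ := d.factorial * 2 ^ d * (2 + M) ^ (d + 1)
    + d.factorial * (4 * M + 4 * M ^ 2) ^ d * 2 ^ (d + 1) with hK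
  have hint : Integrable fun w : E => K * (1 + ‖w‖) ^ (-((d + 1 : ℕ) : ℝ)) :=
    (integrable_one_add_norm (by simp)).const_mul K
  refine hint.mono' (measurable_detIntegrand y).aestronglyMeasurable (ae_of_all _ fun w => ?_)
  have h0 : 0 < 1 + ‖w‖ := by positivity
  rw [Real.rpow_neg h0.le, Real.rpow_natCast, ← div_eq_mul_inv, le_div_iff₀ (by positivity),
    Real.norm_eq_abs]
  rcases le_total (M + 1) ‖w‖ with h | h
  · calc _ ≤ |detIntegrand y w| * (2 * ‖w‖) ^ (d + 1) := by gcongr; linarith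
      _ = |detIntegrand y w| * ‖w‖ ^ (d + 1) * 2 ^ (d + 1) := by ring
      _ ≤ d.factorial * (4 * M + 4 * M ^ 2) ^ d * 2 ^ (d + 1) := by
        exact mul_le_mul_of_nonneg_right (abs_detIntegrand_mul_pow_le hM h) (by positivity)
      _ ≤ K := le_add_of_nonneg_left (by positivity)
  · calc _ ≤ d.factorial * 2 ^ d * (2 + M) ^ (d + 1) := by
          refine mul_le_mul (abs_detIntegrand_le y w) ?_ (by positivity) (by positivity)
          exact pow_le_pow_left₀ h0.le (by linarith) _
      _ ≤ K := le_add_of_nonneg_right (by positivity)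

end Decay

section Cutoff

variable {d : ℕ}

local notation "E" => EuclideanSpace ℝ (Fin d)

/-- A smooth compactly supported radial cutoff function. -/
noncomputable def radialCutoff (x : E) : ℝ := Real.smoothTransition (2 - ‖x‖ ^ 2)

theorem contDiff_radialCutoff : ContDiff ℝ 1 (radialCutoff : E → ℝ) :=
  (Real.smoothTransition.contDiff (n := 1)).comp (contDiff_const.sub (contDiff_norm_sq ℝ))

theorem radialCutoff_of_norm_le {x : E} (h : ‖x‖ ≤ 1) : radialCutoff x = 1 :=
  Real.smoothTransition.one_of_one_le (by nlinarith [norm_nonneg x])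

theorem radialCutoff_of_le_norm {x : E} (h : 2 ≤ ‖x‖) : radialCutoff x = 0 :=
  Real.smoothTransition.zero_of_nonpos (by nlinarith)

theorem hasCompactSupport_radialCutoff : HasCompactSupport (radialCutoff : E → ℝ) :=
  HasCompactSupport.of_support_subset_isCompact (isCompact_closedBall (0 : E) 2) fun x hx => by
    rw [mem_closedBall_zero_iff]
    by_contra! h
    exact hx (radialCutoff_of_le_norm h.le)

theorem abs_radialCutoff_le (x : E) : |radialCutoff x| ≤ 1 :=
  abs_le.2 ⟨by linarith [Real.smoothTransition.nonneg (2 - ‖x‖ ^ 2), radialCutoff.eq_def x],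
    Real.smoothTransition.le_one _⟩

theorem radialCutoff_eq_of_norm_eq {x x' : E} (h : ‖x‖ = ‖x'‖) :
    radialCutoff x = radialCutoff x' := by
  rw [radialCutoff, radialCutoff, h]

theorem integrable_radialCutoff_smul {t : ℝ} (ht : t ≠ 0) :
    Integrable fun w : E => radialCutoff (t • w) :=
  (contDiff_radialCutoff.continuous.integrable_of_hasCompactSupport
    hasCompactSupport_radialCutoff).comp_smul ht

/-- The integral of `detHat` against a radial function vanishes when the points all lie in a
common hyperplane through the origin. -/
theorem integral_detHat_mul_radialCutoff_eq_zero {p : Fin d → E} {m : E} (hm : m ≠ 0)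
    (hp : ∀ j, ⟪m, p j⟫ = 0) {t : ℝ} (ht : t ≠ 0) :
    ∫ w, detHat p w * radialCutoff (t • w) = 0 := by
  have h := two_mul_integral_detHat_mul hm hp (integrable_radialCutoff_smul ht)
  have h0 (z : E) : radialCutoff (t • (ℝ ∙ m)ᗮ.reflection z) = radialCutoff (t • z) :=
    radialCutoff_eq_of_norm_eq (by simp [norm_smul])
  simpa [h0] using h

/-- The points selected by `s` in the multilinear expansion of `detIntegrand`. -/
noncomputable def selectPoints (y : Fin (d + 1) → E) (s : Finset (Fin d)) (j : Fin d) : E :=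
  if j ∈ s then y j.castSucc else y j.succ

theorem detIntegrand_eq_sum (y : Fin (d + 1) → E) (w : E) :
    detIntegrand y w = ∑ s : Finset (Fin d),
      (∏ j, if j ∈ s then 1 else -1) * detHat (selectPoints y s) w := by
  have h := (detCols (d := d)).toMultilinearMap.map_add_univ
    (fun j => unitHat (y j.castSucc - w)) (fun j => -unitHat (y j.succ - w))
  rw [detIntegrand_eq_detCols]
  simp only [sub_eq_add_neg]
  refine h.trans (Finset.sum_congr rfl fun s _ => ?_)
  rw [detHat, ← smul_eq_mul, ← AlternatingMap.map_smul_univ, AlternatingMap.coe_multilinearMap]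
  congr 1
  funext j
  by_cases hj : j ∈ s <;> simp [hj, selectPoints]

/-- If `s` is not everything then the selection misses one of the first `d` points. -/
theorem exists_castSucc_ne {s : Finset (Fin d)} (hs : s ≠ Finset.univ) :
    ∃ i : Fin d, ∀ j, (if j ∈ s then j.castSucc else j.succ) ≠ i.castSucc := by
  by_contra! h
  refine hs (Finset.eq_univ_iff_forall.2 fun i => ?_)
  induction i using WellFoundedLT.induction with
  | _ i ih =>
    obtain ⟨j, hj⟩ := h i
    split_ifs at hj with hjs
    · rwa [← Fin.castSucc_injective _ hj]
    · refine absurd (ih j ?_) hjs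
      rw [Fin.lt_def]
      have := congrArg Fin.val hj
      simp at this
      omega

theorem exists_inner_selectPoints_eq_zero {y : Fin (d + 1) → E} (hy : y (Fin.last d) = 0)
    {s : Finset (Fin d)} (hs : s ≠ Finset.univ) :
    ∃ m : E, m ≠ 0 ∧ ∀ j, ⟪m, selectPoints y s j⟫ = 0 := by
  obtain ⟨i, hi⟩ := exists_castSucc_ne hs
  have h0 : detCols (Function.update (fun j : Fin d => y j.castSucc) i 0) = 0 :=
    detCols.map_coord_zero i (Function.update_self ..)
  obtain ⟨m, hm, hp⟩ := exists_inner_eq_zero h0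
  refine ⟨m, hm, fun j => ?_⟩
  have hsel : selectPoints y s j = y (if j ∈ s then j.castSucc else j.succ) := by
    rw [selectPoints, apply_ite y]
  rw [hsel]
  specialize hi j
  generalize (if j ∈ s then j.castSucc else j.succ) = k at hi
  induction k using Fin.lastCases with
  | last => simp [hy]
  | cast k =>
    have hk : k ≠ i := fun h => hi (by rw [h])
    simpa [Function.update_of_ne hk] using hp k

theorem integral_detIntegrand_mul_radialCutoff {y : Fin (d + 1) → E} (hy : y (Fin.last d) = 0)
    {t : ℝ} (ht : t ≠ 0) :
    ∫ w, detIntegrand y w * radialCutoff (t • w)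
      = ∫ w, detHat (fun j => y j.castSucc) w * radialCutoff (t • w) := by
  simp only [detIntegrand_eq_sum, Finset.sum_mul, mul_assoc]
  rw [integral_finsetSum _ fun s _ =>
    (integrable_detHat_mul _ (integrable_radialCutoff_smul ht)).const_mul _]
  simp only [integral_const_mul]
  rw [Finset.sum_eq_single_of_mem Finset.univ (Finset.mem_univ _)]
  · have h : selectPoints y Finset.univ = fun j => y j.castSucc := by
      funext j
      simp [selectPoints]
    simp [h]
  · intro s _ hs
    obtain ⟨m, hm, hp⟩ := exists_inner_selectPoints_eq_zero hy hs
    rw [integral_detHat_mul_radialCutoff_eq_zero hm hp ht, mul_zero]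

theorem tendsto_integral_mul_radialCutoff {f : E → ℝ} (hf : Integrable f) :
    Tendsto (fun t : ℝ => ∫ w, f w * radialCutoff (t • w)) (𝓝[>] 0) (𝓝 (∫ w, f w)) := by
  have hc : Continuous (radialCutoff : E → ℝ) := contDiff_radialCutoff.continuous
  refine tendsto_integral_filter_of_dominated_convergence (fun w => |f w|) ?_ ?_ hf.abs ?_
  · exact Eventually.of_forall fun t =>
      hf.aestronglyMeasurable.mul (by fun_prop : Continuous _).aestronglyMeasurable
  · refine Eventually.of_forall fun t => ae_of_all _ fun w => ?_
    rw [norm_mul, Real.norm_eq_abs]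
    exact mul_le_of_le_one_right (abs_nonneg _) (abs_radialCutoff_le _)
  · refine ae_of_all _ fun w => ?_
    have h : Continuous fun t : ℝ => f w * radialCutoff (t • w) := by fun_prop
    have h0 := h.tendsto 0
    rw [zero_smul, radialCutoff_of_norm_le (by simp), mul_one] at h0
    exact h0.mono_left nhdsWithin_le_nhds

end Cutoff

section Limit

variable {d : ℕ}

local notation "E" => EuclideanSpace ℝ (Fin d)

theorem integral_inner_sq_mul_eq_of_norm_eq {u v : E} (h : ‖u‖ = ‖v‖) (F : ℝ → ℝ) :
    ∫ x : E, ⟪u, x⟫ ^ 2 * F ‖x‖ = ∫ x : E, ⟪v, x⟫ ^ 2 * F ‖x‖ := by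
  set R := (ℝ ∙ (u - v))ᗮ.reflection
  have hR : R u = v := Submodule.reflection_sub h
  rw [← R.measurePreserving.integral_comp R.toHomeomorph.measurableEmbedding
    (fun x => ⟪v, x⟫ ^ 2 * F ‖x‖)]
  simp only [← hR, R.inner_map_map, R.norm_map]

theorem natCast_mul_integral_inner_sq_mul (m : E) {F : ℝ → ℝ} (hF : Measurable F)
    (hint : Integrable fun x : E => ‖x‖ ^ 2 * F ‖x‖) :
    d * ∫ x : E, ⟪m, x⟫ ^ 2 * F ‖x‖ = ‖m‖ ^ 2 * ∫ x : E, ‖x‖ ^ 2 * F ‖x‖ := by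
  have h1 (i : Fin d) : ∫ x : E, ⟪m, x⟫ ^ 2 * F ‖x‖ = ‖m‖ ^ 2 * ∫ x : E, x i ^ 2 * F ‖x‖ := by
    rw [integral_inner_sq_mul_eq_of_norm_eq (v := ‖m‖ • EuclideanSpace.single i (1 : ℝ))
      (by simp [norm_smul]), ← integral_const_mul]
    congr 1
    funext x
    simp [inner_smul_left, EuclideanSpace.inner_single_left]
    ring
  have h2 (i : Fin d) : Integrable fun x : E => x i ^ 2 * F ‖x‖ := by
    refine hint.mono (by fun_prop) (ae_of_all _ fun x => ?_)
    simp only [norm_mul, norm_pow, norm_norm]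
    gcongr
    exact PiLp.norm_apply_le x i
  calc _ = ∑ i : Fin d, ∫ x : E, ⟪m, x⟫ ^ 2 * F ‖x‖ := by simp
    _ = ∑ i : Fin d, ‖m‖ ^ 2 * ∫ x : E, x i ^ 2 * F ‖x‖ := Finset.sum_congr rfl fun i _ => h1 i
    _ = _ := by
      rw [← Finset.mul_sum, ← integral_finsetSum _ fun i _ => h2 i]
      simp only [← Finset.sum_mul, EuclideanSpace.real_norm_sq_eq]

/-- The derivative of the profile of `radialCutoff` with respect to the squared norm,
up to sign. -/
noncomputable def cutoffDeriv (r : ℝ) : ℝ := deriv Real.smoothTransition (2 - r ^ 2)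

theorem continuous_cutoffDeriv : Continuous cutoffDeriv :=
  (Real.smoothTransition.contDiff (n := 1)).continuous_deriv_one.comp (by fun_prop)

theorem cutoffDeriv_of_two_lt {r : ℝ} (h : 2 < |r|) : cutoffDeriv r = 0 := by
  have h2 : 2 - r ^ 2 < 0 := by nlinarith [sq_abs r]
  have : Real.smoothTransition =ᶠ[𝓝 (2 - r ^ 2)] fun _ => 0 := by
    filter_upwards [Iio_mem_nhds h2] with s hs
    exact Real.smoothTransition.zero_of_nonpos (le_of_lt hs)
  rw [cutoffDeriv, this.deriv_eq, deriv_const]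

theorem hasDerivAt_smoothTransition (s : ℝ) :
    HasDerivAt Real.smoothTransition (deriv Real.smoothTransition s) s :=
  ((Real.smoothTransition.contDiff (n := 1)).differentiable (by simp) s).hasDerivAt

theorem integrable_mul_cutoffDeriv : Integrable fun r : ℝ => r * cutoffDeriv r := by
  refine (continuous_id.mul continuous_cutoffDeriv).integrable_of_hasCompactSupport
    (HasCompactSupport.of_support_subset_isCompact (isCompact_closedBall (0 : ℝ) 2) fun r hr => ?_)
  rw [mem_closedBall_zero_iff, Real.norm_eq_abs]
  by_contra! h
  exact hr (by simp [cutoffDeriv_of_two_lt h])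

theorem integral_Ioi_mul_cutoffDeriv : ∫ r in Ioi (0 : ℝ), r * cutoffDeriv r = 1 / 2 := by
  have hderiv (r : ℝ) : HasDerivAt (fun r => -(1 / 2) * Real.smoothTransition (2 - r ^ 2))
      (r * cutoffDeriv r) r := by
    have h1 : HasDerivAt (fun r : ℝ => 2 - r ^ 2) (-(2 * r)) r := by
      simpa using (hasDerivAt_pow 2 r).const_sub 2
    refine (((hasDerivAt_smoothTransition _).comp r h1).const_mul (-(1 / 2))).congr_deriv ?_
    rw [cutoffDeriv]
    ring
  have hlim : Tendsto (fun r : ℝ => -(1 / 2) * Real.smoothTransition (2 - r ^ 2)) atTop (𝓝 0) := by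
    refine tendsto_const_nhds.congr' ?_
    filter_upwards [eventually_ge_atTop 2] with r hr
    rw [Real.smoothTransition.zero_of_nonpos (by nlinarith), mul_zero]
  rw [integral_Ioi_of_hasDerivAt_of_tendsto' (fun r _ => hderiv r)
    integrable_mul_cutoffDeriv.integrableOn hlim, Real.smoothTransition.one_of_one_le (by norm_num)]
  norm_num

theorem integral_inner_sq_mul_cutoffDeriv (hd : 1 ≤ d) (m : E) :
    ∫ x : E, ⟪m, x⟫ ^ 2 * (cutoffDeriv ‖x‖ / ‖x‖ ^ d)
      = ‖m‖ ^ 2 * ((volume (Metric.ball (0 : E) 1)).toReal / 2) := by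
  have : Nonempty (Fin d) := ⟨⟨0, hd⟩⟩
  have hmeas : Measurable fun r : ℝ => cutoffDeriv r / r ^ d :=
    continuous_cutoffDeriv.measurable.div (by fun_prop)
  have hcancel {r : ℝ} (hr : r ∈ Ioi (0 : ℝ)) :
      r ^ (finrank ℝ E - 1) • (r ^ 2 * (cutoffDeriv r / r ^ d)) = r * cutoffDeriv r := by
    obtain ⟨k, rfl⟩ : ∃ k, d = k + 1 := ⟨d - 1, by omega⟩
    have : r ≠ 0 := ne_of_gt hr
    simp only [finrank_euclideanSpace, Fintype.card_fin, Nat.add_sub_cancel, smul_eq_mul]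
    field_simp
    ring
  have hint : Integrable fun x : E => ‖x‖ ^ 2 * (cutoffDeriv ‖x‖ / ‖x‖ ^ d) := by
    refine (integrable_fun_norm_addHaar volume
      (f := fun r : ℝ => r ^ 2 * (cutoffDeriv r / r ^ d))).2 ?_
    exact integrable_mul_cutoffDeriv.integrableOn.congr_fun (fun r hr => (hcancel hr).symm)
      measurableSet_Ioi
  have h1 := natCast_mul_integral_inner_sq_mul m hmeas hint
  have h2 := integral_fun_norm_addHaar (volume : Measure E)
    (fun r : ℝ => r ^ 2 * (cutoffDeriv r / r ^ d))
  rw [setIntegral_congr_fun measurableSet_Ioi fun r hr => hcancel hr,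
    integral_Ioi_mul_cutoffDeriv] at h2
  rw [h2] at h1
  have hd0 : (d : ℝ) ≠ 0 := by positivity
  refine mul_left_cancel₀ hd0 (h1.trans ?_)
  simp [Measure.real]
  ring

/-- The symmetric difference quotient of `radialCutoff` in the direction `q`. -/
noncomputable def cutoffQuotient (q : E) (t : ℝ) (x : E) : ℝ :=
  t⁻¹ * (radialCutoff (x + t • q) - radialCutoff (x - t • q))

theorem tendsto_cutoffQuotient (q x : E) :
    Tendsto (fun t => cutoffQuotient q t x) (𝓝[>] 0) (𝓝 (-(4 * cutoffDeriv ‖x‖ * ⟪x, q⟫))) := by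
  have hd (q : E) : HasDerivAt (fun t : ℝ => radialCutoff (x + t • q))
      (cutoffDeriv ‖x‖ * -(2 * ⟪x, q⟫)) 0 := by
    have h1 : HasDerivAt (fun t : ℝ => x + t • q) q 0 := by
      simpa using ((hasDerivAt_id (0 : ℝ)).smul_const q).const_add x
    have h2 := h1.norm_sq.const_sub 2
    have h3 := (hasDerivAt_smoothTransition _).comp (0 : ℝ) h2
    simp only [zero_smul, add_zero] at h3
    exact h3
  have h := ((hd q).sub (hd (-q))).tendsto_slope_zero_right
  simp only [zero_add, smul_neg, ← sub_eq_add_neg, zero_smul, inner_neg_right, sub_zero, add_zero,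
    smul_eq_mul, sub_self, Pi.sub_apply] at h
  refine Tendsto.congr (fun t => rfl) (h.trans (le_of_eq ?_))
  congr 1
  ring

theorem detHat_inv_smul {p : Fin d → E} {m q : E} (hp : ∀ j, ⟪m, p j⟫ = 1) (hq : ⟪m, q⟫ = 1)
    {t : ℝ} (ht : 0 < t) (x : E) :
    detHat (fun j => p j - q) (t⁻¹ • x)
      = t ^ d * (t⁻¹ * (-(detCols p * ⟪m, x⟫) / ∏ j, ‖t • (p j - q) - x‖)) := by
  have h1 := detCols_add_inner_smul m (-(t⁻¹ • x + q)) p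
  simp only [hp, one_smul, inner_neg_right, inner_add_right, inner_smul_right, hq] at h1
  have h2 (j) : t • (p j - q) - x = t • (p j + -(t⁻¹ • x + q)) := by
    rw [← sub_eq_add_neg, smul_sub, smul_sub, smul_add, smul_inv_smul₀ ht.ne']
    abel
  rw [← detHat_smul ht, smul_inv_smul₀ ht.ne', detHat_eq_div]
  have h3 := (detCols (d := d)).map_smul_univ (fun _ => t) (fun j => p j + -(t⁻¹ • x + q))
  have h4 : detCols (fun j => t • (p j - q) - x)
      = t ^ d * (t⁻¹ * (-(detCols p * ⟪m, x⟫))) := by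
    simp only [h2]
    rw [h3, h1]
    simp only [Finset.prod_const, Finset.card_univ, Fintype.card_fin, smul_eq_mul]
    ring
  rw [h4]
  ring

theorem two_mul_integral_detHat_mul_radialCutoff {p : Fin d → E} {m : E} (hm : m ≠ 0)
    (hp : ∀ j, ⟪m, p j⟫ = 1) {q : E} (hq : q = (‖m‖ ^ 2)⁻¹ • m) {t : ℝ} (ht : 0 < t) :
    2 * ∫ w, detHat p w * radialCutoff (t • w)
      = ∫ x, -(detCols p * ⟪m, x⟫) / (∏ j, ‖t • (p j - q) - x‖) * cutoffQuotient q t x := by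
  have hm' : ‖m‖ ^ 2 ≠ 0 := pow_ne_zero 2 (norm_ne_zero_iff.2 hm)
  have hmq : ⟪m, q⟫ = 1 := by
    rw [hq, inner_smul_right, real_inner_self_eq_norm_sq, inv_mul_cancel₀ hm']
  have hRq : (ℝ ∙ m)ᗮ.reflection q = -q := by
    rw [hq, map_smul, Submodule.reflection_orthogonalComplement_singleton_eq_neg, smul_neg]
  have hR (z : E) : radialCutoff (t • ((ℝ ∙ m)ᗮ.reflection z + q)) = radialCutoff (t • (z - q)) := by
    refine radialCutoff_eq_of_norm_eq ?_
    rw [norm_smul, norm_smul, ← (ℝ ∙ m)ᗮ.reflection.norm_map (z - q), map_sub, hRq, sub_neg_eq_add]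
  have h1 := two_mul_integral_detHat_mul (p := fun j => p j - q) hm
    (fun j => by rw [inner_sub_right, hp, hmq, sub_self])
    ((integrable_radialCutoff_smul ht.ne').comp_add_right q)
  rw [← integral_add_right_eq_self _ q]
  simp only [detHat_sub_add]
  rw [h1]
  simp only [hR]
  have h2 := Measure.integral_comp_smul (volume : Measure E)
    (fun z => detHat (fun j => p j - q) z * (radialCutoff (t • (z + q)) - radialCutoff (t • (z - q))))
    t⁻¹
  have htd : (0 : ℝ) < t ^ d := pow_pos ht d
  rw [finrank_euclideanSpace, Fintype.card_fin, inv_pow, inv_inv, abs_of_pos htd, smul_eq_mul] at h2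
  refine mul_left_cancel₀ htd.ne' (h2.symm.trans ?_)
  rw [← integral_const_mul]
  congr 1
  funext x
  rw [detHat_inv_smul hp hmq ht, smul_add, smul_sub, smul_inv_smul₀ ht.ne', cutoffQuotient]
  ring

end Limit

section Main

variable {d : ℕ}

local notation "E" => EuclideanSpace ℝ (Fin d)

theorem abs_detQuotient_le {p : Fin d → E} {C : NNReal} (hC : LipschitzWith C (radialCutoff : E → ℝ))
    {m q : E} {P D t : ℝ} (hP : ∀ j, ‖p j‖ ≤ P) (ht : 0 < t) (htP : t * P ≤ 1 / 4)
    (htq : t * ‖q‖ ≤ 1 / 4) (x : E) :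
    |-(D * ⟪m, x⟫) / (∏ j, ‖t • p j - x‖) * cutoffQuotient q t x|
      ≤ (Metric.closedBall (0 : E) 3).indicator
        (fun _ => |D| * (‖m‖ * 3) / (1 / 4) ^ d * (2 * C * ‖q‖)) x := by
  have hnq : ‖t • q‖ ≤ 1 / 4 := by rwa [norm_smul, Real.norm_of_nonneg ht.le]
  have hquot : |cutoffQuotient q t x| ≤ 2 * C * ‖q‖ := by
    rw [cutoffQuotient, abs_mul, abs_inv, abs_of_pos ht, inv_mul_le_iff₀ ht]
    refine (hC.dist_le_mul (x + t • q) (x - t • q)).trans (le_of_eq ?_)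
    rw [dist_eq_norm, add_sub_sub_cancel, ← two_smul ℝ, norm_smul, norm_smul,
      Real.norm_of_nonneg ht.le, Real.norm_two]
    ring
  have habs := norm_add_le (x + t • q) (-(t • q))
  have habs' := norm_add_le (x - t • q) (t • q)
  rw [add_neg_cancel_right, norm_neg] at habs
  rw [sub_add_cancel] at habs'
  rcases lt_or_ge ‖x‖ (1 / 2) with hx | hx
  · have h1 : radialCutoff (x + t • q) = 1 :=
      radialCutoff_of_norm_le (by linarith [norm_add_le x (t • q)])
    have h2 : radialCutoff (x - t • q) = 1 :=
      radialCutoff_of_norm_le (by linarith [norm_sub_le x (t • q)])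
    rw [cutoffQuotient, h1, h2, sub_self, mul_zero, mul_zero, abs_zero]
    exact indicator_nonneg (fun _ _ => by positivity) x
  rcases lt_or_ge 3 ‖x‖ with hx3 | hx3
  · have h1 : radialCutoff (x + t • q) = 0 := radialCutoff_of_le_norm (by linarith)
    have h2 : radialCutoff (x - t • q) = 0 := radialCutoff_of_le_norm (by linarith)
    rw [cutoffQuotient, h1, h2, sub_self, mul_zero, mul_zero, abs_zero]
    exact indicator_nonneg (fun _ _ => by positivity) x
  rw [indicator_of_mem (mem_closedBall_zero_iff.2 hx3), abs_mul, abs_div, abs_neg, abs_mul]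
  have hprod : (1 / 4 : ℝ) ^ d ≤ |∏ j, ‖t • p j - x‖| := by
    rw [abs_of_nonneg (Finset.prod_nonneg fun _ _ => norm_nonneg _)]
    calc (1 / 4 : ℝ) ^ d = ∏ _j : Fin d, (1 / 4 : ℝ) := by simp
      _ ≤ _ := Finset.prod_le_prod (fun _ _ => by norm_num) fun j _ => by
        have h1 : ‖t • p j‖ ≤ 1 / 4 := by
          rw [norm_smul, Real.norm_of_nonneg ht.le]
          exact (mul_le_mul_of_nonneg_left (hP j) ht.le).trans htP
        have := norm_sub_norm_le x (t • p j)
        rw [norm_sub_rev] at this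
        linarith
  have hinner : |⟪m, x⟫| ≤ ‖m‖ * 3 :=
    (abs_real_inner_le_norm m x).trans (mul_le_mul_of_nonneg_left hx3 (norm_nonneg m))
  gcongr

theorem measurable_cutoffQuotient (q : E) (t : ℝ) : Measurable (cutoffQuotient q t) := by
  have hc : Continuous (radialCutoff : E → ℝ) := contDiff_radialCutoff.continuous
  have : Continuous fun x => t⁻¹ * (radialCutoff (x + t • q) - radialCutoff (x - t • q)) := by
    fun_prop
  exact this.measurable

theorem tendsto_integral_detQuotient (p : Fin d → E) (m q : E) (D : ℝ) :
    Tendsto (fun t => ∫ x, -(D * ⟪m, x⟫) / (∏ j, ‖t • p j - x‖) * cutoffQuotient q t x)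
      (𝓝[>] 0)
      (𝓝 (∫ x, -(D * ⟪m, x⟫) / ‖x‖ ^ d * -(4 * cutoffDeriv ‖x‖ * ⟪x, q⟫))) := by
  obtain ⟨C, hC⟩ := contDiff_radialCutoff.lipschitzWith_of_hasCompactSupport
    (hasCompactSupport_radialCutoff (d := d)) one_ne_zero
  set P := ∑ j, ‖p j‖
  have hP (j) : ‖p j‖ ≤ P := Finset.single_le_sum (f := fun j => ‖p j‖)
    (fun _ _ => norm_nonneg _) (Finset.mem_univ j)
  have hP0 : 0 ≤ P := Finset.sum_nonneg fun _ _ => norm_nonneg _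
  refine tendsto_integral_filter_of_dominated_convergence
    ((Metric.closedBall (0 : E) 3).indicator
        (fun _ => |D| * (‖m‖ * 3) / (1 / 4) ^ d * (2 * C * ‖q‖))) ?_ ?_ ?_ ?_
  · refine Eventually.of_forall fun t => Measurable.aestronglyMeasurable ?_
    refine Measurable.mul (Measurable.div (by fun_prop) ?_) (measurable_cutoffQuotient q t)
    exact Finset.measurable_prod _ fun j _ => by fun_prop
  · have hpos : 0 < 1 / (4 * (P + ‖q‖ + 1)) := by positivity
    filter_upwards [Ioo_mem_nhdsGT hpos] with t ht
    have ht1 : t * (4 * (P + ‖q‖ + 1)) ≤ 1 := ((lt_div_iff₀ (by positivity)).1 ht.2).le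
    have h1 := mul_nonneg ht.1.le hP0
    have h2 := mul_nonneg ht.1.le (norm_nonneg q)
    exact ae_of_all _ fun x => abs_detQuotient_le hC hP ht.1 (by linarith [ht.1])
      (by linarith [ht.1]) x
  · exact (integrable_indicator_iff measurableSet_closedBall).2
      (integrableOn_const (measure_closedBall_lt_top).ne)
  · refine ae_of_all _ fun x => ?_
    rcases eq_or_ne x 0 with rfl | hx
    · simp
    refine Tendsto.mul (Tendsto.div tendsto_const_nhds ?_ ?_) (tendsto_cutoffQuotient q x)
    · have hc : Continuous fun t : ℝ => ∏ j, ‖t • p j - x‖ :=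
        continuous_finsetProd _ fun j _ => by fun_prop
      have h0 := hc.tendsto 0
      simp only [zero_smul, zero_sub, norm_neg, Finset.prod_const, Finset.card_univ,
        Fintype.card_fin] at h0
      exact h0.mono_left nhdsWithin_le_nhds
    · exact pow_ne_zero _ (norm_ne_zero_iff.2 hx)

theorem tendsto_integral_detHat_mul_radialCutoff (hd : 1 ≤ d) (p : Fin d → E) :
    Tendsto (fun t : ℝ => ∫ w, detHat p w * radialCutoff (t • w)) (𝓝[>] 0)
      (𝓝 ((volume (Metric.ball (0 : E) 1)).toReal * detCols p)) := by
  rcases eq_or_ne (detCols p) 0 with h | h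
  · obtain ⟨m, hm, hp⟩ := exists_inner_eq_zero h
    rw [h, mul_zero]
    refine tendsto_const_nhds.congr' ?_
    filter_upwards [self_mem_nhdsWithin] with t ht
    rw [integral_detHat_mul_radialCutoff_eq_zero hm hp (ne_of_gt ht)]
  obtain ⟨m, hp⟩ := exists_inner_eq_one h
  have hm : m ≠ 0 := by
    rintro rfl
    simpa using hp ⟨0, hd⟩
  have hm' : ‖m‖ ≠ 0 := norm_ne_zero_iff.2 hm
  set q := (‖m‖ ^ 2)⁻¹ • m with hq
  have hlim := (tendsto_integral_detQuotient (fun j => p j - q) m q (detCols p)).const_mul (1 / 2)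
  have hval : 1 / 2 * ∫ x, -(detCols p * ⟪m, x⟫) / ‖x‖ ^ d * -(4 * cutoffDeriv ‖x‖ * ⟪x, q⟫)
      = (volume (Metric.ball (0 : E) 1)).toReal * detCols p := by
    have (x : E) : -(detCols p * ⟪m, x⟫) / ‖x‖ ^ d * -(4 * cutoffDeriv ‖x‖ * ⟪x, q⟫)
        = 4 * detCols p * (‖m‖ ^ 2)⁻¹ * (⟪m, x⟫ ^ 2 * (cutoffDeriv ‖x‖ / ‖x‖ ^ d)) := by
      rw [hq, inner_smul_right, real_inner_comm]
      ring
    simp only [this]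
    rw [integral_const_mul, integral_inner_sq_mul_cutoffDeriv hd]
    field_simp
    ring
  rw [hval] at hlim
  refine hlim.congr' ?_
  filter_upwards [self_mem_nhdsWithin] with t ht
  rw [← two_mul_integral_detHat_mul_radialCutoff hm hp hq ht]
  ring

end Main

/-- the determinant form of the geometric identity:
the integrand is Lebesgue-integrable on `ℝ^d` and
`∫_{ℝ^d} det((y₁−w)^ − (y₂−w)^, …, (y_d−w)^ − (y_{d+1}−w)^) dw = vol(B₁) · det(y₁,…,y_d)`. -/
theorem det_geometric_identity_continuum {d : ℕ} (hd : 1 ≤ d)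
    (y : Fin (d + 1) → EuclideanSpace ℝ (Fin d)) (hy : y (Fin.last d) = 0) :
    Integrable (fun w => detIntegrand y w) volume ∧
    ∫ w, detIntegrand y w =
      (volume (Metric.ball (0 : EuclideanSpace ℝ (Fin d)) 1)).toReal *
        (Matrix.of fun i j : Fin d => y j.castSucc i).det := by
  refine ⟨integrable_detIntegrand y, ?_⟩
  have h1 := tendsto_integral_mul_radialCutoff (integrable_detIntegrand y)
  have h2 := tendsto_integral_detHat_mul_radialCutoff hd fun j => y j.castSucc
  rw [← detCols_apply fun j => y j.castSucc]
  refine tendsto_nhds_unique h1 (h2.congr' ?_)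
  filter_upwards [self_mem_nhdsWithin] with t ht
  rw [integral_detIntegrand_mul_radialCutoff hy (ne_of_gt ht)]
end

section
/- Let 0 < r < R, let L ⊆ ℝ^d be an (r,R)-Delone set with d a positive even integer, fix Clifford data γ₁, …, γ_d ∈ M_n(ℂ) (n = 2^{d/2}) as in the context, and let δ, δ′ : L → ℝ^d be two acceptable sets of shifts, i.e. maps with bounded range such that x − δ(x) ≠ 0 and x − δ′(x) ≠ 0 for all x ∈ L. If S is a bounded linear operator on ℓ²(L; ℂⁿ) satisfying (Sψ)(x) = [ γ·((x − δ(x))^) − γ·((x − δ′(x))^) ] (ψ(x)) for all ψ ∈ ℓ²(L; ℂⁿ) and all x ∈ L, then S is a compact operator. (This says that the phases D̂_{L,δ} and D̂_{L,δ′} of the two Dirac operators differ by a compact operator.) -/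
open scoped Classical

/-- `γ · v = Σ_j v_j γ_j`. -/
noncomputable def gammaDot {d n : ℕ} (γ : Fin d → Matrix (Fin n) (Fin n) ℂ)
    (v : EuclideanSpace ℝ (Fin d)) : Matrix (Fin n) (Fin n) ℂ :=
  ∑ j : Fin d, (v j : ℂ) • γ j

open Filter

/-- An operator on `ℓᵖ` of locally compact spaces that is pointwise bounded by a factor vanishing
at infinity is compact. -/
theorem lp.isCompactOperator_of_eventually_norm_apply_le {𝕜 ι : Type*} [NontriviallyNormedField 𝕜]
    {E : ι → Type*} [∀ i, NormedAddCommGroup (E i)] [∀ i, NormedSpace 𝕜 (E i)]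
    [∀ i, CompleteSpace (E i)] [∀ i, LocallyCompactSpace (E i)]
    {p : ENNReal} [Fact (1 ≤ p)] (S : lp E p →L[𝕜] lp E p)
    (hS : ∀ ε : ℝ, 0 < ε → ∀ᶠ i in cofinite, ∀ ψ : lp E p, ‖S ψ i‖ ≤ ε * ‖ψ i‖) :
    IsCompactOperator S := by
  let T (s : Finset ι) : lp E p →L[𝕜] lp E p :=
    ∑ i ∈ s, lp.singleContinuousLinearMap 𝕜 E p i ∘L lp.evalCLM 𝕜 E p i ∘L S
  have hT (s : Finset ι) : T s ∈ compactOperator (RingHom.id 𝕜) (lp E p) (lp E p) :=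
    sum_mem fun i _ ↦
      (isCompactOperator_of_locallyCompactSpace_dom (lp.evalCLM 𝕜 E p i ∘L S)).clm_comp
        (lp.singleContinuousLinearMap 𝕜 E p i)
  have hTapply (s : Finset ι) (ψ : lp E p) (i : ι) : T s ψ i = if i ∈ s then S ψ i else 0 := by
    have h : T s ψ = ∑ j ∈ s, lp.single p j (S ψ j) := by simp [T, lp.evalCLM]
    simp only [h, lp.coeFn_single, lp.coeFn_sum, Finset.sum_apply, Finset.sum_pi_single]
  have hp : p ≠ 0 := (zero_lt_one.trans_le Fact.out).ne'
  refine isCompactOperator_of_tendsto (l := atTop) (F := T) ?_ (Eventually.of_forall hT)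
  refine Metric.tendsto_atTop.2 fun ε hε ↦ ?_
  have hfin := eventually_cofinite.1 (hS (ε / 2) (half_pos hε))
  refine ⟨hfin.toFinset, fun s hs ↦ ?_⟩
  rw [dist_comm, dist_eq_norm]
  refine lt_of_le_of_lt (ContinuousLinearMap.opNorm_le_bound _ (half_pos hε).le fun ψ ↦ ?_)
    (half_lt_self hε)
  calc ‖(S - T s) ψ‖ ≤ ‖(ε / 2) • (⟨fun i ↦ ‖ψ i‖, (lp.memℓp ψ).norm⟩ : lp (fun _ : ι ↦ ℝ) p)‖ := by
        refine lp.norm_mono hp fun i ↦ ?_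
        rw [_root_.sub_apply, lp.coeFn_sub, Pi.sub_apply, hTapply]
        split_ifs with hi
        · rw [sub_self, _root_.norm_zero]
          positivity
        · have : ∀ φ : lp E p, ‖S φ i‖ ≤ ε / 2 * ‖φ i‖ := by
            by_contra h
            exact hi (hs (hfin.mem_toFinset.2 h))
          simpa [norm_mul, abs_of_pos hε] using this ψ
    _ ≤ ε / 2 * ‖ψ‖ := by
        rw [norm_smul, Real.norm_of_nonneg (half_pos hε).le]
        gcongr
        exact lp.norm_mono hp fun i ↦ by simp

theorem norm_unitHat_sub_unitHat_le {d : ℕ} {u v : EuclideanSpace ℝ (Fin d)} (hu : u ≠ 0)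
    (hv : v ≠ 0) : ‖unitHat u - unitHat v‖ ≤ 2 * ‖u - v‖ / ‖u‖ := by
  have hu' : 0 < ‖u‖ := norm_pos_iff.2 hu
  have hv' : 0 < ‖v‖ := norm_pos_iff.2 hv
  have hsplit : unitHat u - unitHat v = ‖u‖⁻¹ • (u - v) + (‖u‖⁻¹ - ‖v‖⁻¹) • v := by
    rw [unitHat, unitHat, if_neg hu, if_neg hv]
    module
  have hradial : ‖(‖u‖⁻¹ - ‖v‖⁻¹) • v‖ ≤ ‖u - v‖ / ‖u‖ := by
    have h : (‖u‖⁻¹ - ‖v‖⁻¹) * ‖v‖ = (‖v‖ - ‖u‖) / ‖u‖ := by field_simp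
    rw [norm_smul, ← Real.norm_of_nonneg hv'.le, ← norm_mul, norm_norm, h, norm_div, norm_norm]
    gcongr
    rw [← norm_neg (u - v), neg_sub]
    exact abs_norm_sub_norm_le v u
  calc ‖unitHat u - unitHat v‖ ≤ ‖‖u‖⁻¹ • (u - v)‖ + ‖(‖u‖⁻¹ - ‖v‖⁻¹) • v‖ :=
        hsplit ▸ norm_add_le _ _
    _ ≤ ‖u - v‖ / ‖u‖ + ‖u - v‖ / ‖u‖ := by
        gcongr
        rw [norm_smul, norm_inv, norm_norm, div_eq_inv_mul]
    _ = 2 * ‖u - v‖ / ‖u‖ := by ring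

theorem norm_toEuclideanCLM_gammaDot_sub_le {d n : ℕ} (γ : Fin d → Matrix (Fin n) (Fin n) ℂ)
    (u v : EuclideanSpace ℝ (Fin d)) :
    ‖Matrix.toEuclideanCLM (𝕜 := ℂ) (gammaDot γ u - gammaDot γ v)‖ ≤
      (∑ j, ‖Matrix.toEuclideanCLM (𝕜 := ℂ) (γ j)‖) * ‖u - v‖ := by
  have h : gammaDot γ u - gammaDot γ v = ∑ j, ((u j - v j : ℝ) : ℂ) • γ j := by
    simp [gammaDot, sub_smul, Finset.sum_sub_distrib]
  rw [h, map_sum, Finset.sum_mul]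
  refine norm_sum_le_of_le _ fun j _ ↦ ?_
  rw [map_smul, norm_smul, mul_comm, Complex.norm_real]
  gcongr
  exact PiLp.norm_apply_le (u - v) j

theorem Metric.finite_inter_of_isCompact_of_subsingleton_inter_ball {X : Type*}
    [PseudoMetricSpace X] {L K : Set X} {r : ℝ} (hr : 0 < r)
    (hL : ∀ x, (L ∩ Metric.ball x r).Subsingleton) (hK : IsCompact K) : (L ∩ K).Finite := by
  obtain ⟨t, -, ht, hKt⟩ := hK.finite_cover_balls hr
  refine (ht.biUnion fun x _ ↦ (hL x).finite).subset ?_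
  rintro y ⟨hyL, hyK⟩
  obtain ⟨x, hx, hyx⟩ := Set.mem_iUnion₂.1 (hKt hyK)
  exact Set.mem_biUnion hx ⟨hyL, hyx⟩

/-- In a uniformly discrete subset of a proper space, the norm tends to infinity. -/
theorem tendsto_norm_cofinite_of_subsingleton_inter_ball {X : Type*} [SeminormedAddCommGroup X]
    [ProperSpace X] {L : Set X} {r : ℝ} (hr : 0 < r)
    (hL : ∀ x, (L ∩ Metric.ball x r).Subsingleton) :
    Tendsto (fun x : L ↦ ‖(x : X)‖) cofinite atTop := by
  refine tendsto_atTop.2 fun B ↦ eventually_cofinite.2 ?_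
  have hfin := Metric.finite_inter_of_isCompact_of_subsingleton_inter_ball hr hL
    (isCompact_closedBall 0 B)
  refine (hfin.preimage Subtype.val_injective.injOn).subset fun x hx ↦ ⟨x.2, ?_⟩
  exact mem_closedBall_zero_iff.2 (not_le.1 hx).le

/-- for an `(r,R)`-Delone set `L ⊆ ℝ^d` (`d` even) and two acceptable sets of
shifts `δ, δ′`, any bounded operator `S` on `ℓ²(L; ℂⁿ)` acting pointwise by the matrix
`γ·((x − δ(x))^) − γ·((x − δ′(x))^)` is compact; i.e. the phases of the two Dirac operators
differ by a compact operator. -/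
theorem dirac_phase_difference_compact {d : ℕ} (hd : 0 < d) (hdeven : Even d)
    {n : ℕ} (hn : n = 2 ^ (d / 2))
    (γ : Fin d → Matrix (Fin n) (Fin n) ℂ)
    (hγ : ∀ i j, γ i * γ j + γ j * γ i = (if i = j then (2 : ℂ) else 0) • 1)
    {r R : ℝ} (hr : 0 < r) (hrR : r < R)
    (L : Set (EuclideanSpace ℝ (Fin d)))
    (hUD : ∀ x, (L ∩ Metric.ball x r).Subsingleton)
    (hRD : ∀ x, (L ∩ Metric.ball x R).Nonempty)
    (δ δ' : L → EuclideanSpace ℝ (Fin d))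
    (hδbdd : ∃ M : ℝ, ∀ x : L, ‖δ x‖ ≤ M)
    (hδ'bdd : ∃ M : ℝ, ∀ x : L, ‖δ' x‖ ≤ M)
    (hδ : ∀ x : L, (x : EuclideanSpace ℝ (Fin d)) - δ x ≠ 0)
    (hδ' : ∀ x : L, (x : EuclideanSpace ℝ (Fin d)) - δ' x ≠ 0)
    (S : lp (fun _ : L => EuclideanSpace ℂ (Fin n)) 2 →L[ℂ]
      lp (fun _ : L => EuclideanSpace ℂ (Fin n)) 2)
    (hS : ∀ (ψ : lp (fun _ : L => EuclideanSpace ℂ (Fin n)) 2) (x : L),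
      (S ψ) x = (WithLp.equiv 2 (Fin n → ℂ)).symm
        ((gammaDot γ (unitHat ((x : EuclideanSpace ℝ (Fin d)) - δ x)) -
          gammaDot γ (unitHat ((x : EuclideanSpace ℝ (Fin d)) - δ' x))).mulVec
          (WithLp.equiv 2 (Fin n → ℂ) (ψ x)))) :
    IsCompactOperator S := by
  obtain ⟨M, hM⟩ := hδbdd
  obtain ⟨M', hM'⟩ := hδ'bdd
  set C := ∑ j, ‖Matrix.toEuclideanCLM (𝕜 := ℂ) (γ j)‖
  have hC : 0 ≤ C := Finset.sum_nonneg fun _ _ ↦ norm_nonneg _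
  have hlim : Tendsto (fun x : L ↦ C * (2 * (M + M') / (‖(x : EuclideanSpace ℝ (Fin d))‖ - M)))
      cofinite (nhds 0) := by
    have hden := tendsto_atTop_add_const_right cofinite (-M)
      (tendsto_norm_cofinite_of_subsingleton_inter_ball hr hUD)
    simpa [sub_eq_add_neg] using (hden.const_div_atTop (2 * (M + M'))).const_mul C
  refine lp.isCompactOperator_of_eventually_norm_apply_le S fun ε hε ↦ ?_
  filter_upwards [hlim.eventually_le_const hε,
    (tendsto_norm_cofinite_of_subsingleton_inter_ball hr hUD).eventually_gt_atTop M]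
    with x hxε hxM ψ
  set u := (x : EuclideanSpace ℝ (Fin d)) - δ x with hu
  set v := (x : EuclideanSpace ℝ (Fin d)) - δ' x with hv
  have huv : ‖u - v‖ ≤ M + M' := by
    rw [hu, hv, sub_sub_sub_cancel_left]
    linarith [norm_sub_le (δ' x) (δ x), hM x, hM' x]
  have hxu : ‖(x : EuclideanSpace ℝ (Fin d))‖ - M ≤ ‖u‖ := by
    linarith [norm_sub_norm_le (x : EuclideanSpace ℝ (Fin d)) (δ x), hM x]
  have hpos : 0 < ‖(x : EuclideanSpace ℝ (Fin d))‖ - M := sub_pos.2 hxM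
  have hsymbol :
      ‖Matrix.toEuclideanCLM (𝕜 := ℂ) (gammaDot γ (unitHat u) - gammaDot γ (unitHat v))‖ ≤ ε :=
    calc _ ≤ C * ‖unitHat u - unitHat v‖ := norm_toEuclideanCLM_gammaDot_sub_le γ _ _
      _ ≤ C * (2 * ‖u - v‖ / ‖u‖) := by
          gcongr
          exact norm_unitHat_sub_unitHat_le (hδ x) (hδ' x)
      _ ≤ C * (2 * (M + M') / (‖(x : EuclideanSpace ℝ (Fin d))‖ - M)) := by
          have : 0 ≤ M + M' := (norm_nonneg _).trans huv
          gcongr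
      _ ≤ ε := hxε
  rw [hS]
  exact ContinuousLinearMap.le_of_opNorm_le _ hsymbol (ψ x)
end

section
/- Let d ≥ 1, 0 < r < R, let L ⊆ ℝ^d be an (r,R)-Delone set, and let δ, δ′ : L → ℝ^d be two acceptable sets of shifts, i.e. maps with bounded range such that x − δ(x) ≠ 0 and x − δ′(x) ≠ 0 for all x ∈ L. Then the family ( | ‖x − δ(x)‖^{−d} − ‖x − δ′(x)‖^{−d} | )_{x ∈ L} is summable, i.e. Σ_{x ∈ L} | ‖x − δ(x)‖^{−d} − ‖x − δ′(x)‖^{−d} | < ∞. (This is the content of the statement that |D_{L,δ}|^{−d} − |D_{L,δ′}|^{−d} is a trace class operator.) -/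
open MeasureTheory in
/-- Negative powers beyond the dimension are summable over a uniformly separated set. -/
theorem summable_inv_one_add_norm_pow {E : Type*} [NormedAddCommGroup E] [NormedSpace ℝ E]
    [FiniteDimensional ℝ E] [MeasurableSpace E] [BorelSpace E] {r : ℝ} (hr : 0 < r)
    {L : Set E} (hL : ∀ x, (L ∩ Metric.ball x r).Subsingleton) {n : ℕ}
    (hn : Module.finrank ℝ E < n) :
    Summable fun x : L => ((1 + ‖(x : E)‖) ^ n)⁻¹ := by
  let μ : Measure E := Measure.addHaar
  let f : E → ℝ := fun y => ((1 + ‖y‖) ^ n)⁻¹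
  have hf : Integrable f μ := by
    have h := integrable_one_add_norm (E := E) (μ := μ) (r := n) (by exact_mod_cast hn)
    refine h.congr (Filter.Eventually.of_forall fun y => ?_)
    simp only [f]
    rw [Real.rpow_neg (by positivity), Real.rpow_natCast]
  have hf0 : ∀ y, 0 ≤ f y := fun y => by positivity
  let c : ℝ := μ.real (Metric.ball (0 : E) (r / 2))
  have hc : 0 < c := ENNReal.toReal_pos
    (Metric.measure_ball_pos μ _ (half_pos hr)).ne' measure_ball_lt_top.ne
  have hdisj : Pairwise (Function.onFun Disjoint
      fun x : L => Metric.ball (x : E) (r / 2)) := by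
    intro x y hxy
    refine Metric.ball_disjoint_ball ?_
    by_contra! h
    refine hxy (Subtype.ext (hL x ⟨x.2, Metric.mem_ball_self hr⟩ ⟨y.2, ?_⟩))
    rw [Metric.mem_ball, dist_comm]
    linarith
  have hlow : ∀ x : L, c * ((1 + r / 2) ^ n)⁻¹ * f x ≤
      ∫ y in Metric.ball (x : E) (r / 2), f y ∂μ := by
    intro x
    have hμ : μ.real (Metric.ball (x : E) (r / 2)) = c := by
      simp only [c, measureReal_def, Measure.addHaar_ball_center]
    have h := setIntegral_ge_of_const_le_real (μ := μ) (f := f)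
      (c := ((1 + r / 2) ^ n)⁻¹ * f x) (s := Metric.ball (x : E) (r / 2))
      Metric.isOpen_ball.measurableSet measure_ball_lt_top.ne (fun y hy => ?_) hf.integrableOn
    · rw [hμ] at h
      linarith
    · simp only [f]
      rw [← mul_inv, ← mul_pow]
      rw [Metric.mem_ball, dist_eq_norm] at hy
      have h1 : ‖y‖ ≤ ‖(x : E)‖ + ‖y - x‖ := by
        simpa using norm_add_le (x : E) (y - x)
      gcongr
      nlinarith [norm_nonneg (x : E)]
  have hsum : Summable fun x : L => c * ((1 + r / 2) ^ n)⁻¹ * f x := by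
    refine summable_of_sum_le (c := ∫ y, f y ∂μ)
      (fun x => mul_nonneg (by positivity) (hf0 _)) fun s => ?_
    calc ∑ x ∈ s, c * ((1 + r / 2) ^ n)⁻¹ * f x
        ≤ ∑ x ∈ s, ∫ y in Metric.ball (x : E) (r / 2), f y ∂μ :=
          Finset.sum_le_sum fun x _ => hlow x
      _ = ∫ y in ⋃ x ∈ s, Metric.ball (x : E) (r / 2), f y ∂μ :=
          (integral_biUnion_finset s (fun x _ => Metric.isOpen_ball.measurableSet)
            (hdisj.set_pairwise _) fun x _ => hf.integrableOn).symm
      _ ≤ ∫ y, f y ∂μ := setIntegral_le_integral hf (Filter.Eventually.of_forall hf0)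
  exact (summable_mul_left_iff (by positivity)).1 hsum

/-- Lipschitz estimate for `t ↦ t⁻ᵈ` on `[m⁻¹, ∞)`. -/
theorem abs_inv_pow_sub_inv_pow_le {a b m : ℝ} (ha : 0 < a) (hb : 0 < b)
    (ham : a⁻¹ ≤ m) (hbm : b⁻¹ ≤ m) {d : ℕ} (hd : 1 ≤ d) :
    |(a ^ d)⁻¹ - (b ^ d)⁻¹| ≤ |a - b| * d * m ^ (d + 1) := by
  have hm : 0 ≤ m := (inv_pos.2 ha).le.trans ham
  have hdiff : |a⁻¹ - b⁻¹| ≤ |a - b| * m ^ 2 := by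
    have h : a⁻¹ - b⁻¹ = (b - a) * (a⁻¹ * b⁻¹) := by field_simp
    rw [h, abs_mul, abs_sub_comm, abs_of_pos (by positivity : 0 < a⁻¹ * b⁻¹), sq]
    gcongr
  have hmax : max |a⁻¹| |b⁻¹| ≤ m := by
    rw [abs_of_pos (inv_pos.2 ha), abs_of_pos (inv_pos.2 hb)]
    exact max_le ham hbm
  calc |(a ^ d)⁻¹ - (b ^ d)⁻¹| = |a⁻¹ ^ d - b⁻¹ ^ d| := by rw [inv_pow, inv_pow]
    _ ≤ |a⁻¹ - b⁻¹| * d * max |a⁻¹| |b⁻¹| ^ (d - 1) := abs_pow_sub_pow_le _ _ _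
    _ ≤ |a - b| * m ^ 2 * d * m ^ (d - 1) := by gcongr
    _ = |a - b| * d * m ^ (d + 1) := by
      obtain ⟨k, rfl⟩ := Nat.exists_eq_add_of_le' hd
      rw [Nat.add_sub_cancel]
      ring


/-- for an `(r,R)`-Delone set `L ⊆ ℝ^d` and two acceptable sets of shifts
`δ, δ′` (bounded, with `x − δ(x) ≠ 0` and `x − δ′(x) ≠ 0` on `L`), the family
`x ↦ |‖x − δ(x)‖^{−d} − ‖x − δ′(x)‖^{−d}|` is summable over `L`. -/
theorem dirac_inverse_power_diff_summable {d : ℕ} (hd : 1 ≤ d) {r R : ℝ}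
    (hr : 0 < r) (hrR : r < R)
    (L : Set (EuclideanSpace ℝ (Fin d)))
    (hUD : ∀ x, (L ∩ Metric.ball x r).Subsingleton)
    (hRD : ∀ x, (L ∩ Metric.ball x R).Nonempty)
    (δ δ' : L → EuclideanSpace ℝ (Fin d))
    (hδbdd : ∃ M : ℝ, ∀ x : L, ‖δ x‖ ≤ M)
    (hδ'bdd : ∃ M : ℝ, ∀ x : L, ‖δ' x‖ ≤ M)
    (hδ : ∀ x : L, (x : EuclideanSpace ℝ (Fin d)) - δ x ≠ 0)
    (hδ' : ∀ x : L, (x : EuclideanSpace ℝ (Fin d)) - δ' x ≠ 0) :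
    Summable fun x : L =>
      |(‖(x : EuclideanSpace ℝ (Fin d)) - δ x‖ ^ d)⁻¹ -
        (‖(x : EuclideanSpace ℝ (Fin d)) - δ' x‖ ^ d)⁻¹| := by
  obtain ⟨M₁, hM₁⟩ := hδbdd
  obtain ⟨M₂, hM₂⟩ := hδ'bdd
  set M := max 0 (max M₁ M₂)
  have hM0 : 0 ≤ M := le_max_left _ _
  replace hM₁ : ∀ x, ‖δ x‖ ≤ M := fun x =>
    (hM₁ x).trans ((le_max_left _ _).trans (le_max_right _ _))
  replace hM₂ : ∀ x, ‖δ' x‖ ≤ M := fun x =>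
    (hM₂ x).trans ((le_max_right _ _).trans (le_max_right _ _))
  have hsum := summable_inv_one_add_norm_pow hr hUD (n := d + 1) (by simp)
  have hlarge : ∀ᶠ x : L in Filter.cofinite,
      2 * M + 1 < ‖(x : EuclideanSpace ℝ (Fin d))‖ := by
    have h := hsum.tendsto_cofinite_zero.eventually_lt_const
      (show 0 < ((1 + (2 * M + 1)) ^ (d + 1))⁻¹ by positivity)
    filter_upwards [h] with x hx
    have h1 := lt_of_pow_lt_pow_left₀ _ (by positivity)
      ((inv_lt_inv₀ (by positivity) (by positivity)).1 hx)
    linarith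
  refine Summable.of_norm_bounded_eventually (hsum.mul_left (2 * M * d * 4 ^ (d + 1))) ?_
  filter_upwards [hlarge] with x hx
  have hinv : ∀ v : EuclideanSpace ℝ (Fin d), ‖v‖ ≤ M →
      ‖(x : EuclideanSpace ℝ (Fin d)) - v‖⁻¹ ≤
        4 / (1 + ‖(x : EuclideanSpace ℝ (Fin d))‖) := by
    intro v hv
    have h := norm_sub_norm_le (x : EuclideanSpace ℝ (Fin d)) v
    rw [← inv_div]
    gcongr
    linarith
  have hab : |‖(x : EuclideanSpace ℝ (Fin d)) - δ x‖ -
      ‖(x : EuclideanSpace ℝ (Fin d)) - δ' x‖| ≤ 2 * M := by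
    refine (abs_norm_sub_norm_le _ _).trans ?_
    rw [sub_sub_sub_cancel_left]
    linarith [norm_sub_le (δ' x) (δ x), hM₁ x, hM₂ x]
  rw [Real.norm_eq_abs, abs_abs]
  calc _ ≤ _ := abs_inv_pow_sub_inv_pow_le (norm_pos_iff.2 (hδ x)) (norm_pos_iff.2 (hδ' x))
        (hinv _ (hM₁ x)) (hinv _ (hM₂ x)) hd
    _ ≤ 2 * M * d * (4 / (1 + ‖(x : EuclideanSpace ℝ (Fin d))‖)) ^ (d + 1) := by gcongr
    _ = _ := by rw [div_pow]; ring
end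

section
/- Let d ≥ 1, let αℝ^d be the one-point compactification of ℝ^d (with added point ∞), and let ρ be any metric on αℝ^d inducing its topology. Then the set { L ∪ {∞} : L a closed subset of ℝ^d } is a compact subset of the space of nonempty compact subsets of αℝ^d equipped with the Hausdorff metric induced by ρ. In particular, the space of patterns (𝒞(ℝ^d), D), with D(L, L′) the Hausdorff distance between L ∪ {∞} and L′ ∪ {∞}, is a bounded, compact and complete metric space. -/
open TopologicalSpace

namespace TopologicalSpace.NonemptyCompacts

theorem isClosed_setOfPred_mem {α : Type*} [TopologicalSpace α] [T1Space α] (x : α) :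
    IsClosed {K : NonemptyCompacts α | x ∈ (K : Set α)} := by
  simpa only [Set.inter_singleton_nonempty] using
    isClosed_inter_nonempty_of_isClosed (isClosed_singleton (x := x))

end TopologicalSpace.NonemptyCompacts

theorem OnePoint.exists_isClosed_eq_insert_infty_iff {α : Type*} [TopologicalSpace α]
    {s : Set (OnePoint α)} (hs : IsClosed s) :
    (∃ L : Set α, IsClosed L ∧ s = insert OnePoint.infty (OnePoint.some '' L)) ↔
      OnePoint.infty ∈ s := by
  constructor
  · rintro ⟨L, -, rfl⟩
    exact Set.mem_insert _ _
  · intro h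
    refine ⟨OnePoint.some ⁻¹' s, hs.preimage OnePoint.continuous_coe, ?_⟩
    ext x
    induction x using OnePoint.rec <;> simp [h]

/-- let `X` be a metric space homeomorphic (via `φ`) to the one-point
compactification `αℝ^d` of `ℝ^d` (i.e. `X` realizes an arbitrary metric on `αℝ^d`
inducing its topology).  Then the collection `{L ∪ {∞} : L closed in ℝ^d}`, viewed inside
the space of nonempty compact subsets of `X` with its Hausdorff metric, is compact.
This expresses that the space of patterns `(𝒞(ℝ^d), D)` is a compact (hence bounded and
complete) metric space. -/
theorem space_of_patterns_compact {d : ℕ} (hd : 1 ≤ d) {X : Type*} [MetricSpace X]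
    (φ : OnePoint (EuclideanSpace ℝ (Fin d)) ≃ₜ X) :
    IsCompact {K : NonemptyCompacts X |
      ∃ L : Set (EuclideanSpace ℝ (Fin d)), IsClosed L ∧
        (K : Set X) = φ '' (insert OnePoint.infty (OnePoint.some '' L))} := by
  have : CompactSpace X := φ.compactSpace
  convert (NonemptyCompacts.isClosed_setOfPred_mem (φ OnePoint.infty)).isCompact using 1
  ext K
  have hK : IsClosed (φ ⁻¹' (K : Set X)) := K.isCompact.isClosed.preimage φ.continuous
  have h_image (s : Set (OnePoint (EuclideanSpace ℝ (Fin d)))) :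
      (K : Set X) = φ '' s ↔ φ ⁻¹' (K : Set X) = s := by
    rw [← φ.surjective.preimage_injective.eq_iff, φ.preimage_image]
  simp only [Set.mem_ofPred_eq, h_image]
  exact OnePoint.exists_isClosed_eq_insert_infty_iff hK
end

section
/- Let d ≥ 1, let αℝ^d be the one-point compactification of ℝ^d, and let ρ be any metric on αℝ^d inducing its topology. Equip the set 𝒞(ℝ^d) of closed subsets of ℝ^d with the metric D(L, L′) = Hausdorff distance between L ∪ {∞} and L′ ∪ {∞}. Then the translation action map 𝔱 : ℝ^d × 𝒞(ℝ^d) → 𝒞(ℝ^d), 𝔱(a, L) = L − a := { x − a : x ∈ L }, is jointly continuous; in particular, for each a ∈ ℝ^d the map L ↦ L − a is a homeomorphism of (𝒞(ℝ^d), D), so ℝ^d acts on the space of patterns by homeomorphisms. -/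
/-- The pattern metric: `D(L, L′)` is the Hausdorff distance, computed in a metric
realization `X` of the one-point compactification of `ℝ^d`, between `L ∪ {∞}` and
`L′ ∪ {∞}`. -/
noncomputable def patternDist {d : ℕ} {X : Type*} [MetricSpace X]
    (φ : OnePoint (EuclideanSpace ℝ (Fin d)) ≃ₜ X)
    (L L' : Set (EuclideanSpace ℝ (Fin d))) : ℝ :=
  Metric.hausdorffDist (φ '' (insert OnePoint.infty (OnePoint.some '' L)))
    (φ '' (insert OnePoint.infty (OnePoint.some '' L')))

open Filter Topology in
/-- Translations of a proper normed group, extended to the one-point compactification by fixing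
`∞`, depend jointly continuously on the translation vector and the point. -/
theorem OnePoint.continuous_map_sub {E : Type*} [NormedAddCommGroup E] [ProperSpace E] :
    Continuous fun p : E × OnePoint E => OnePoint.map (fun x => x - p.1) p.2 := by
  rw [continuous_iff_continuousAt]
  rintro ⟨a, x⟩
  induction x using OnePoint.rec with
  | infty =>
    rw [ContinuousAt, nhds_prod_eq, OnePoint.nhds_infty_eq, prod_sup, tendsto_sup]
    constructor
    · rw [prod_map_right, tendsto_map'_iff]
      have hsub : Tendsto (fun p : E × E => p.2 - p.1) (𝓝 a ×ˢ coclosedCompact E)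
          (coclosedCompact E) := by
        rw [coclosedCompact_eq_cocompact, ← Metric.cobounded_eq_cocompact,
          ← tendsto_norm_atTop_iff_cobounded]
        have hfst : Tendsto (fun p : E × E => -‖p.1‖) (𝓝 a ×ˢ Bornology.cobounded E)
            (𝓝 (-‖a‖)) := (tendsto_fst.norm).neg
        have hsnd : Tendsto (fun p : E × E => ‖p.2‖) (𝓝 a ×ˢ Bornology.cobounded E) atTop :=
          tendsto_norm_cobounded_atTop.comp tendsto_snd
        exact tendsto_atTop_mono (fun p => by linarith [norm_sub_norm_le p.2 p.1])
          (hsnd.atTop_add hfst)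
      have hcoe : Tendsto ((↑) : E → OnePoint E) (coclosedCompact E) (𝓝 OnePoint.infty) := by
        rw [OnePoint.nhds_infty_eq]
        exact tendsto_map.mono_right le_sup_left
      exact hcoe.comp hsub
    · rw [prod_pure, tendsto_map'_iff]
      exact tendsto_const_nhds
  | coe x =>
    rw [ContinuousAt, nhds_prod_eq, OnePoint.nhds_coe_eq, prod_map_right, tendsto_map'_iff]
    exact (OnePoint.continuous_coe.tendsto (x - a)).comp (tendsto_snd.sub tendsto_fst)

open Filter Topology in
/-- A jointly continuous family of self-maps of a compact metric space is, near each parameter,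
uniformly continuous in the point and the parameter together. -/
theorem Continuous.exists_dist_lt_of_compactSpace {E X : Type*} [SeminormedAddCommGroup E]
    [WeaklyLocallyCompactSpace E] [PseudoMetricSpace X] [CompactSpace X] {F : E → X → X}
    (hF : Continuous fun p : E × X => F p.1 p.2) (a : E) {ε : ℝ} (hε : 0 < ε) :
    ∃ δ > 0, ∀ b, ‖b - a‖ < δ → ∀ x y, dist x y < δ → dist (F b x) (F a y) < ε := by
  have hFa : UniformContinuous (F a) :=
    CompactSpace.uniformContinuous_of_continuous (hF.comp (Continuous.prodMk_right a))
  obtain ⟨δ₁, hδ₁, h₁⟩ := Metric.uniformContinuous_iff.1 hFa (ε / 2) (half_pos hε)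
  obtain ⟨δ₂, hδ₂, h₂⟩ := Metric.eventually_nhds_iff.1
    (Metric.tendstoUniformly_iff.1 (Continuous.tendstoUniformly F hF a) (ε / 2) (half_pos hε))
  refine ⟨min δ₁ δ₂, lt_min hδ₁ hδ₂, fun b hb x y hxy => ?_⟩
  have hbx := h₂ (y := b) (by rw [dist_eq_norm]; exact hb.trans_le (min_le_right _ _)) x
  have hxy' := h₁ (hxy.trans_le (min_le_left _ _))
  rw [dist_comm] at hbx
  linarith [dist_triangle (F b x) (F a x) (F a y)]

/-- If `f` and `g` send `δ`-close points to `ε`-close points, then images under `f` and `g` of sets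
at Hausdorff distance less than `δ` are at Hausdorff distance at most `ε`. -/
theorem Metric.hausdorffDist_image_le_of_dist_lt {X Y : Type*} [PseudoMetricSpace X]
    [PseudoMetricSpace Y] {f g : X → Y} {A B : Set X} {δ ε : ℝ} (hε : 0 ≤ ε)
    (hfg : ∀ x y, dist x y < δ → dist (f x) (g y) ≤ ε)
    (hfin : Metric.hausdorffEDist A B ≠ ⊤) (hAB : Metric.hausdorffDist A B < δ) :
    Metric.hausdorffDist (f '' A) (g '' B) ≤ ε := by
  apply Metric.hausdorffDist_le_of_mem_dist hε
  · rintro _ ⟨x, hx, rfl⟩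
    obtain ⟨y, hy, hxy⟩ := Metric.exists_dist_lt_of_hausdorffDist_lt hx hAB hfin
    exact ⟨g y, ⟨y, hy, rfl⟩, hfg x y hxy⟩
  · rintro _ ⟨y, hy, rfl⟩
    obtain ⟨x, hx, hxy⟩ := Metric.exists_dist_lt_of_hausdorffDist_lt' hy hAB hfin
    exact ⟨f x, ⟨x, hx, rfl⟩, by rw [dist_comm]; exact hfg x y hxy⟩


/-- the translation action `𝔱(a, L) = L − a` of `ℝ^d` on the space of
patterns `(𝒞(ℝ^d), D)` is jointly continuous (stated in `ε`–`δ` form at every point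
`(a, L)` with `L` closed): for every `ε > 0` there is `δ > 0` such that whenever
`‖b − a‖ < δ` and `D(L′, L) < δ` (with `L′` closed), one has
`D(L′ − b, L − a) < ε`. -/
theorem translation_action_continuous {d : ℕ} (hd : 1 ≤ d) {X : Type*} [MetricSpace X]
    (φ : OnePoint (EuclideanSpace ℝ (Fin d)) ≃ₜ X)
    (a : EuclideanSpace ℝ (Fin d)) (L : Set (EuclideanSpace ℝ (Fin d))) (hL : IsClosed L) :
    ∀ ε > 0, ∃ δ > 0, ∀ (b : EuclideanSpace ℝ (Fin d))
      (L' : Set (EuclideanSpace ℝ (Fin d))), IsClosed L' →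
      ‖b - a‖ < δ → patternDist φ L' L < δ →
      patternDist φ ((fun x => x - b) '' L') ((fun x => x - a) '' L) < ε := by
  intro ε hε
  have : CompactSpace X := φ.compactSpace
  set F : EuclideanSpace ℝ (Fin d) → X → X :=
    fun c x => φ (OnePoint.map (fun z => z - c) (φ.symm x)) with hFdef
  have hF : Continuous fun p : EuclideanSpace ℝ (Fin d) × X => F p.1 p.2 :=
    φ.continuous.comp (OnePoint.continuous_map_sub.comp
      (continuous_fst.prodMk (φ.symm.continuous.comp continuous_snd)))
  have hFimage : ∀ c M, φ '' (insert OnePoint.infty (OnePoint.some '' ((fun x => x - c) '' M))) =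
      F c '' (φ '' (insert OnePoint.infty (OnePoint.some '' M))) := by
    intro c M
    simp only [hFdef, Set.image_insert_eq, Set.image_image, Homeomorph.symm_apply_apply,
      OnePoint.map_infty, OnePoint.map_some]
  obtain ⟨δ, hδ, hclose⟩ := hF.exists_dist_lt_of_compactSpace a (half_pos hε)
  refine ⟨δ, hδ, fun b L' _ hb hdist => ?_⟩
  unfold patternDist at hdist ⊢
  rw [hFimage, hFimage]
  refine (Metric.hausdorffDist_image_le_of_dist_lt (half_pos hε).le
    (fun x y hxy => (hclose b hb x y hxy).le) ?_ hdist).trans_lt (half_lt_self hε)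
  exact Metric.hausdorffEDist_ne_top_of_nonempty_of_bounded
    ((Set.insert_nonempty _ _).image _) ((Set.insert_nonempty _ _).image _)
    (Bornology.IsBounded.all _) (Bornology.IsBounded.all _)
end

section
/- Let W₁, W₂, m be real numbers with W₁ > 0, W₂ > 0, m > 0, W₁ ≠ 2 and W₂ ≠ 2m. Then ∫_{−1/2}^{1/2} ( ln|1 + W₁ u| − ln|m + W₂ u| ) du = (1/W₁ + 1/2)·ln(2 + W₁) − (1/W₁ − 1/2)·ln|2 − W₁| + (m/W₂ − 1/2)·ln|2m − W₂| − (m/W₂ + 1/2)·ln(2m + W₂). Consequently the disorder-averaged zero-energy Lyapunov exponent Λ of the one-dimensional model with hopping t = 1 + W₁ξ₀ and mass m + W₂ξ₀, with ξ₀ uniformly distributed on [−1/2, 1/2], equals the absolute value of the right-hand side, i.e. Λ = | ln[ (2+W₁)^{1/W₁+1/2} / |2−W₁|^{1/W₁−1/2} · |2m−W₂|^{m/W₂−1/2} / (2m+W₂)^{m/W₂+1/2} ] |. -/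
open MeasureTheory in
theorem intervalIntegrable_log_abs_affine (c W a b : ℝ) :
    IntervalIntegrable (fun u => Real.log |c + W * u|) volume a b := by
  have h : MeromorphicOn (fun u : ℝ => c + W * u) (Set.uIcc a b) := fun x _ =>
    AnalyticAt.meromorphicAt (by fun_prop)
  exact h.intervalIntegrable_log_norm

theorem integral_log_abs_affine {c W : ℝ} (hW : 0 < W) (hc : 0 < c) (h : W ≠ 2 * c) :
    ∫ u in (-(1 : ℝ) / 2)..(1 / 2), Real.log |c + W * u| =
      (c / W + 1 / 2) * Real.log (2 * c + W) - (c / W - 1 / 2) * Real.log |2 * c - W|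
        - 1 - Real.log 2 := by
  have h₁ : Real.log (c + W * (1 / 2)) = Real.log (2 * c + W) - Real.log 2 := by
    rw [← Real.log_div (by positivity) two_ne_zero]
    congr 1
    ring
  have h₂ : Real.log (c + W * (-1 / 2)) = Real.log (2 * c - W) - Real.log 2 := by
    rw [← Real.log_div (sub_ne_zero.2 h.symm) two_ne_zero]
    congr 1
    ring
  simp only [Real.log_abs]
  rw [intervalIntegral.integral_comp_add_mul Real.log hW.ne' c, integral_log, h₁, h₂, smul_eq_mul]
  field_simp
  ring

/-- the explicit evaluation of the disorder average
`∫_{−1/2}^{1/2} (ln|1 + W₁u| − ln|m + W₂u|) du`, and the resulting formula for the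
zero-energy Lyapunov exponent
`Λ = |ln[(2+W₁)^{1/W₁+1/2}/|2−W₁|^{1/W₁−1/2} · |2m−W₂|^{m/W₂−1/2}/(2m+W₂)^{m/W₂+1/2}]|`. -/
theorem lyapunov_exponent_formula (W₁ W₂ m : ℝ) (hW₁ : 0 < W₁) (hW₂ : 0 < W₂)
    (hm : 0 < m) (h₁ : W₁ ≠ 2) (h₂ : W₂ ≠ 2 * m) :
    (∫ u in (-(1 : ℝ) / 2)..(1 / 2),
        (Real.log |1 + W₁ * u| - Real.log |m + W₂ * u|)) =
      (1 / W₁ + 1 / 2) * Real.log (2 + W₁) - (1 / W₁ - 1 / 2) * Real.log |2 - W₁|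
        + (m / W₂ - 1 / 2) * Real.log |2 * m - W₂|
        - (m / W₂ + 1 / 2) * Real.log (2 * m + W₂) ∧
    |∫ u in (-(1 : ℝ) / 2)..(1 / 2),
        (Real.log |1 + W₁ * u| - Real.log |m + W₂ * u|)| =
      |Real.log ((2 + W₁) ^ (1 / W₁ + 1 / 2) / |2 - W₁| ^ (1 / W₁ - 1 / 2) *
        (|2 * m - W₂| ^ (m / W₂ - 1 / 2) / (2 * m + W₂) ^ (m / W₂ + 1 / 2)))| := by
  have key : (∫ u in (-(1 : ℝ) / 2)..(1 / 2),
        (Real.log |1 + W₁ * u| - Real.log |m + W₂ * u|)) =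
      (1 / W₁ + 1 / 2) * Real.log (2 + W₁) - (1 / W₁ - 1 / 2) * Real.log |2 - W₁|
        + (m / W₂ - 1 / 2) * Real.log |2 * m - W₂|
        - (m / W₂ + 1 / 2) * Real.log (2 * m + W₂) := by
    rw [intervalIntegral.integral_sub (intervalIntegrable_log_abs_affine ..)
        (intervalIntegrable_log_abs_affine ..),
      integral_log_abs_affine hW₁ one_pos (by simpa using h₁), integral_log_abs_affine hW₂ hm h₂,
      mul_one]
    ring
  refine ⟨key, ?_⟩
  have p₁ : 0 < |2 - W₁| := abs_pos.2 (sub_ne_zero.2 h₁.symm)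
  have p₂ : 0 < |2 * m - W₂| := abs_pos.2 (sub_ne_zero.2 h₂.symm)
  have q₁ : 0 < 2 + W₁ := by positivity
  have q₂ : 0 < 2 * m + W₂ := by positivity
  rw [key, Real.log_mul (by positivity) (by positivity), Real.log_div (by positivity) (by positivity),
    Real.log_div (by positivity) (by positivity), Real.log_rpow q₁, Real.log_rpow p₁,
    Real.log_rpow p₂, Real.log_rpow q₂, add_sub_assoc]
end

section
/- Let d ≥ 1 and let y₁, …, y_{d+1} ∈ ℝ^d be affinely independent points, and let w be an interior point of their convex hull (the simplex 𝔖 = [y₁, …, y_{d+1}]). For each j ∈ {1, …, d+1}, let C_j := { w + Σ_{i ≠ j} t_i (y_i − w) : t_i ≥ 0 for all i ≠ j } be the translated closed convex cone generated at w by the directions toward the vertices other than y_j. Then ⋃_{j=1}^{d+1} C_j = ℝ^d, and for every i ≠ j the intersection C_i ∩ C_j has Lebesgue measure zero. -/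
open MeasureTheory

/-- The translated closed convex cone generated at `w` by the directions toward the
vertices `y_i`, `i ≠ j`, of the simplex:
`C_j = { w + Σ_{i ≠ j} t_i (y_i − w) : t_i ≥ 0 }`. -/
def vertexCone {d : ℕ} (y : Fin (d + 1) → EuclideanSpace ℝ (Fin d))
    (w : EuclideanSpace ℝ (Fin d)) (j : Fin (d + 1)) : Set (EuclideanSpace ℝ (Fin d)) :=
  {p | ∃ t : Fin (d + 1) → ℝ, (∀ i, 0 ≤ t i) ∧
    p = w + ∑ i ∈ Finset.univ.erase j, t i • (y i - w)}

/-- The barycentric coordinates of a combination of the directions `b i - w` based at `w`. -/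
theorem AffineBasis.coord_add_sum_smul_sub {ι V : Type*} [DecidableEq ι]
    [AddCommGroup V] [Module ℝ V] (b : AffineBasis ι ℝ V) (w : V) (s : Finset ι) (t : ι → ℝ)
    (k : ι) :
    b.coord k (w + ∑ i ∈ s, t i • (b i - w)) =
      (if k ∈ s then t k else 0) + (1 - ∑ i ∈ s, t i) * b.coord k w := by
  have hlin : ∀ i, (b.coord k).linear (b i - w) = (if k = i then 1 else 0) - b.coord k w := by
    intro i
    rw [← vsub_eq_sub, AffineMap.linearMap_vsub, b.coord_apply, vsub_eq_sub]
  rw [add_comm w, ← vadd_eq_add, AffineMap.map_vadd, map_sum, vadd_eq_add]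
  simp only [map_smul, hlin, smul_eq_mul, mul_sub, Finset.sum_sub_distrib, mul_ite, mul_one,
    mul_zero, Finset.sum_ite_eq, ← Finset.sum_mul]
  ring

/-- A point of the `j`-th vertex cone minimizes, at `j`, the ratio of its barycentric coordinates
to those of the apex `w`. -/
theorem coord_mul_le_of_mem_vertexCone {d : ℕ}
    (b : AffineBasis (Fin (d + 1)) ℝ (EuclideanSpace ℝ (Fin d)))
    {w p : EuclideanSpace ℝ (Fin d)} (hw : ∀ i, 0 < b.coord i w) {j : Fin (d + 1)}
    (hp : p ∈ vertexCone b w j) (k : Fin (d + 1)) :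
    b.coord j p * b.coord k w ≤ b.coord k p * b.coord j w := by
  obtain ⟨t, ht, rfl⟩ := hp
  have hnn : 0 ≤ (if k ∈ Finset.univ.erase j then t k else 0) := by
    split_ifs
    exacts [ht k, le_rfl]
  rw [b.coord_add_sum_smul_sub, b.coord_add_sum_smul_sub, if_neg (Finset.notMem_erase _ _)]
  nlinarith [mul_nonneg hnn (hw j).le]

/-- A point at which the ratio of barycentric coordinates to those of the apex `w` is minimal
at `j` lies in the `j`-th vertex cone. -/
theorem mem_vertexCone_of_forall_div_le {d : ℕ}
    (b : AffineBasis (Fin (d + 1)) ℝ (EuclideanSpace ℝ (Fin d)))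
    {w p : EuclideanSpace ℝ (Fin d)} (hw : ∀ i, 0 < b.coord i w) {j : Fin (d + 1)}
    (hj : ∀ k, b.coord j p / b.coord j w ≤ b.coord k p / b.coord k w) :
    p ∈ vertexCone b w j := by
  set r := b.coord j p / b.coord j w with hr
  refine ⟨fun k => b.coord k p - r * b.coord k w, fun k => ?_, ?_⟩
  · exact sub_nonneg.2 ((le_div_iff₀ (hw k)).1 (hj k))
  · have hzero : b.coord j p - r * b.coord j w = 0 := by
      rw [hr, div_mul_cancel₀ _ (hw j).ne', sub_self]
    rw [Finset.sum_erase _ (by simp only [hzero, zero_smul])]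
    simp only [sub_smul, smul_sub, mul_smul, Finset.sum_sub_distrib, ← Finset.smul_sum,
      ← Finset.sum_smul, b.sum_coord_apply_eq_one, b.linear_combination_coord_eq_self, one_smul]
    simp

/-- The zero set of an affine function that is not identically zero is Lebesgue-null. -/
theorem volume_setOf_affineMap_eq_zero {d : ℕ} (f : EuclideanSpace ℝ (Fin d) →ᵃ[ℝ] ℝ)
    {q : EuclideanSpace ℝ (Fin d)} (hq : f q ≠ 0) : volume {p | f p = 0} = 0 := by
  have hset : {p | f p = 0} = ((AffineSubspace.mk' (0 : ℝ) ⊥).comap f : Set _) := by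
    ext p
    simp [AffineSubspace.mem_mk']
  rw [hset]
  refine Measure.addHaar_affineSubspace volume _ fun htop => hq ?_
  have hmem : q ∈ (AffineSubspace.mk' (0 : ℝ) ⊥).comap f := htop ▸ AffineSubspace.mem_top ℝ _ q
  simpa [AffineSubspace.mem_mk'] using hmem

/-- if `y₁, …, y_{d+1}` are affinely independent and `w` is an interior point
of their convex hull, then the cones `C_j` cover `ℝ^d`, and any two distinct cones intersect
in a Lebesgue-null set. -/
theorem vertexCones_cover {d : ℕ} (hd : 1 ≤ d)
    (y : Fin (d + 1) → EuclideanSpace ℝ (Fin d)) (hy : AffineIndependent ℝ y)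
    (w : EuclideanSpace ℝ (Fin d))
    (hw : w ∈ interior (convexHull ℝ (Set.range y))) :
    (⋃ j : Fin (d + 1), vertexCone y w j) = Set.univ ∧
    ∀ i j : Fin (d + 1), i ≠ j → volume (vertexCone y w i ∩ vertexCone y w j) = 0 := by
  have htop : affineSpan ℝ (Set.range y) = ⊤ :=
    hy.affineSpan_eq_top_iff_card_eq_finrank_add_one.2 (by simp)
  obtain ⟨b, rfl⟩ : ∃ b : AffineBasis (Fin (d + 1)) ℝ (EuclideanSpace ℝ (Fin d)), ⇑b = y :=
    ⟨⟨y, hy, htop⟩, rfl⟩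
  rw [b.interior_convexHull] at hw
  replace hw : ∀ i, 0 < b.coord i w := hw
  refine ⟨Set.eq_univ_of_forall fun p => ?_, fun i j hij => ?_⟩
  · obtain ⟨j, hj⟩ := Finite.exists_min fun k => b.coord k p / b.coord k w
    exact Set.mem_iUnion.2 ⟨j, mem_vertexCone_of_forall_div_le b hw hj⟩
  · let f : EuclideanSpace ℝ (Fin d) →ᵃ[ℝ] ℝ := b.coord j w • b.coord i - b.coord i w • b.coord j
    have hf : ∀ p, f p = b.coord j w * b.coord i p - b.coord i w * b.coord j p := fun _ => rfl
    have hne : f (b i) ≠ 0 := by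
      rw [hf, b.coord_apply_eq, b.coord_apply_ne hij.symm]
      simpa using (hw j).ne'
    refine measure_mono_null (fun p hp => ?_) (volume_setOf_affineMap_eq_zero f hne)
    have hle := coord_mul_le_of_mem_vertexCone b hw hp.1 j
    have hge := coord_mul_le_of_mem_vertexCone b hw hp.2 i
    rw [Set.mem_ofPred_eq, hf]
    linarith
end
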